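/- Any two heptagonal typical 7-configurations can be joined by a Q-deformation; i.e., the heptagonal typical 7-configurations form a single Q-deformation class. -/

import Mathlib

open scoped LinearAlgebra.Projectivization
open Projectivization

noncomputable section

/-- The real projective plane: the projectivization of `ℝ³`. -/
abbrev RP2 := ℙ ℝ (Fin 3 → ℝ)

/-- The quotient topology on the real projective plane. -/
instance : TopologicalSpace RP2 :=
  inferInstanceAs (TopologicalSpace (Quotient (projectivizationSetoid ℝ (Fin 3 → ℝ))))

/-- Three points of `ℙ²(ℝ)` are collinear if they admit linearly dependent representatives. -/
def Collin (a b c : RP2) : Prop :=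
  ¬ LinearIndependent ℝ ![a.rep, b.rep, c.rep]

/-- The conic (zero set in `ℙ²(ℝ)`) associated to a quadratic form on `ℝ³`. -/
def ConicSet (q : QuadraticForm ℝ (Fin 3 → ℝ)) : Set RP2 := {p : RP2 | q p.rep = 0}

/-- A set of points is coconic if some conic contains all of them. -/
def Coconic (s : Set RP2) : Prop :=
  ∃ q : QuadraticForm ℝ (Fin 3 → ℝ), q ≠ 0 ∧ ∀ p ∈ s, q p.rep = 0

/-- A labeled `n`-configuration is simple if it is injective and has no collinear triple. -/
def SimpleCfg {n : ℕ} (f : Fin n → RP2) : Prop :=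
  Function.Injective f ∧
    ∀ i j k : Fin n, i ≠ j → i ≠ k → j ≠ k → ¬ Collin (f i) (f j) (f k)

/-- A labeled `n`-configuration is typical if it is simple and no six of its points are coconic. -/
def TypicalCfg {n : ℕ} (f : Fin n → RP2) : Prop :=
  SimpleCfg f ∧ ∀ g : Fin 6 → Fin n, Function.Injective g → ¬ Coconic (Set.range (f ∘ g))

/-- A projective line: the set of points whose representatives lie in a 2-dimensional
subspace of `ℝ³`. -/
def IsProjLine (L : Set RP2) : Prop :=
  ∃ W : Submodule ℝ (Fin 3 → ℝ), Module.finrank ℝ W = 2 ∧ L = {p : RP2 | p.rep ∈ W}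

/-- `p` lies inside the conic of `q` if every projective line through `p` meets the conic. -/
def InsideConic (q : QuadraticForm ℝ (Fin 3 → ℝ)) (p : RP2) : Prop :=
  ∀ L : Set RP2, IsProjLine L → p ∈ L → (L ∩ ConicSet q).Nonempty

/-- `p` lies outside the conic of `q` if some projective line through `p` misses the conic. -/
def OutsideConic (q : QuadraticForm ℝ (Fin 3 → ℝ)) (p : RP2) : Prop :=
  ∃ L : Set RP2, IsProjLine L ∧ p ∈ L ∧ L ∩ ConicSet q = ∅

/-- A point `f i` of a configuration is dominant if it lies outside every conic passing
through all the other points of the configuration. -/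
def Dominant {n : ℕ} (f : Fin n → RP2) (i : Fin n) : Prop :=
  ∀ q : QuadraticForm ℝ (Fin 3 → ℝ), q ≠ 0 → (∀ j, j ≠ i → q ((f j).rep) = 0) →
    OutsideConic q (f i)

/-- A point `f i` of a configuration is subdominant if it lies inside every conic passing
through all the other points of the configuration. -/
def Subdominant {n : ℕ} (f : Fin n → RP2) (i : Fin n) : Prop :=
  ∀ q : QuadraticForm ℝ (Fin 3 → ℝ), q ≠ 0 → (∀ j, j ≠ i → q ((f j).rep) = 0) →
    InsideConic q (f i)

/-- The affine chart determined by a nonzero linear functional `φ` (with `L∞ = {φ = 0}`):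
a point off `L∞` is sent to its representative rescaled to lie on the affine plane `φ = 1`. -/
def chart (φ : (Fin 3 → ℝ) →ₗ[ℝ] ℝ) (p : RP2) : Fin 3 → ℝ := (φ p.rep)⁻¹ • p.rep

/-- Convex position with respect to the affine chart of `φ`: the line `{φ = 0}` misses the
configuration, and in the chart every point lies outside the convex hull of the others. -/
def ConvexPosWith {n : ℕ} (φ : (Fin 3 → ℝ) →ₗ[ℝ] ℝ) (f : Fin n → RP2) : Prop :=
  φ ≠ 0 ∧ (∀ i, φ (f i).rep ≠ 0) ∧
    ∀ i, chart φ (f i) ∉ convexHull ℝ (chart φ '' (f '' {j | j ≠ i}))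

/-- A configuration is in convex position if it is so in some affine chart. -/
def ConvexPos {n : ℕ} (f : Fin n → RP2) : Prop := ∃ φ, ConvexPosWith φ f

/-- The labeling of a configuration is consecutive for the convex position in the chart of `φ`:
each pair `f i`, `f (i+1)` (cyclically) spans an edge of the convex polygon, i.e. is cut out by
an affine functional which is strictly larger on both of them than on all the other points. -/
def ConsecWith {n : ℕ} [NeZero n] (φ : (Fin 3 → ℝ) →ₗ[ℝ] ℝ) (f : Fin n → RP2) : Prop :=
  ConvexPosWith φ f ∧
    ∀ i : Fin n, ∃ ψ : (Fin 3 → ℝ) →ₗ[ℝ] ℝ,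
      ψ (chart φ (f i)) = ψ (chart φ (f (i + 1))) ∧
      ∀ j : Fin n, j ≠ i → j ≠ i + 1 → ψ (chart φ (f j)) < ψ (chart φ (f i))

/-- A configuration is in convex position with consecutive cyclic labeling. -/
def ConsecConvexPos {n : ℕ} [NeZero n] (f : Fin n → RP2) : Prop := ∃ φ, ConsecWith φ f

/-- A Q-deformation (an `n`-tuple of continuous paths through typical configurations). -/
def QDeformFam (n : ℕ) (γ : Fin n → unitInterval → RP2) : Prop :=
  (∀ i, Continuous (γ i)) ∧ ∀ t : unitInterval, TypicalCfg (fun i => γ i t)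

end

noncomputable section

open scoped LinearAlgebra.Projectivization
open Projectivization

/-- The bracket of three vectors of `ℝ³`: the determinant of the matrix they form. -/
def br (a b c : Fin 3 → ℝ) : ℝ :=
  a 0 * (b 1 * c 2 - b 2 * c 1) - a 1 * (b 0 * c 2 - b 2 * c 0) + a 2 * (b 0 * c 1 - b 1 * c 0)

theorem br_rotate (a b c : Fin 3 → ℝ) : br b c a = br a b c := by unfold br; ring

theorem br_swap (a b c : Fin 3 → ℝ) : br b a c = -br a b c := by unfold br; ring

theorem br_swap_right (a b c : Fin 3 → ℝ) : br a c b = -br a b c := by unfold br; ring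

theorem br_self_left (a b : Fin 3 → ℝ) : br a a b = 0 := by unfold br; ring

theorem br_self_right (a b : Fin 3 → ℝ) : br a b b = 0 := by unfold br; ring

theorem br_self_outer (a b : Fin 3 → ℝ) : br a b a = 0 := by unfold br; ring

theorem br_add_right (a b x y : Fin 3 → ℝ) : br a b (x + y) = br a b x + br a b y := by
  simp only [br, Pi.add_apply]; ring

theorem br_smul_right (a b x : Fin 3 → ℝ) (s : ℝ) : br a b (s • x) = s * br a b x := by
  simp only [br, Pi.smul_apply, smul_eq_mul]; ring

theorem br_sub_right (a b x y : Fin 3 → ℝ) : br a b (x - y) = br a b x - br a b y := by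
  simp only [br, Pi.sub_apply]; ring

theorem br_cramer (a b c x : Fin 3 → ℝ) :
    br a b c • x = br x b c • a + br a x c • b + br a b x • c := by
  funext i
  fin_cases i <;> simp [br] <;> ring

theorem br_plucker (o a b c d : Fin 3 → ℝ) :
    br o a b * br o c d - br o a c * br o b d + br o a d * br o b c = 0 := by
  unfold br; ring

/-- A bilinear form whose associated quadratic form defines the conic through `a, b, c, d, e`. -/
def conicForm (a b c d e x y : Fin 3 → ℝ) : ℝ :=
  br a b d * br a c e * (br b c x * br d e y) - br a b c * br a d e * (br b d x * br c e y)

/-- The equation of the conic through `a, b, c, d, e`. -/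
def conic (a b c d e x : Fin 3 → ℝ) : ℝ := conicForm a b c d e x x

/-- The polar form of `conic`. -/
def conicPolar (a b c d e x y : Fin 3 → ℝ) : ℝ :=
  conicForm a b c d e x y + conicForm a b c d e y x

section Conic

variable (a b c d e x y z : Fin 3 → ℝ)

theorem conic_add : conic a b c d e (x + y) =
    conic a b c d e x + conicPolar a b c d e x y + conic a b c d e y := by
  simp only [conic, conicPolar, conicForm, br_add_right]; ring

theorem conic_smul (s : ℝ) : conic a b c d e (s • x) = s ^ 2 * conic a b c d e x := by
  simp only [conic, conicForm, br_smul_right]; ring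

theorem conicPolar_add_right : conicPolar a b c d e x (y + z) =
    conicPolar a b c d e x y + conicPolar a b c d e x z := by
  simp only [conicPolar, conicForm, br_add_right]; ring

theorem conicPolar_add_left : conicPolar a b c d e (x + y) z =
    conicPolar a b c d e x z + conicPolar a b c d e y z := by
  simp only [conicPolar, conicForm, br_add_right]; ring

theorem conicPolar_smul_right (s : ℝ) : conicPolar a b c d e x (s • y) =
    s * conicPolar a b c d e x y := by
  simp only [conicPolar, conicForm, br_smul_right]; ring

theorem conicPolar_smul_left (s : ℝ) : conicPolar a b c d e (s • x) y =
    s * conicPolar a b c d e x y := by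
  simp only [conicPolar, conicForm, br_smul_right]; ring

theorem conicPolar_comm : conicPolar a b c d e x y = conicPolar a b c d e y x := by
  unfold conicPolar; ring

theorem conic_self₁ : conic a b c d e a = 0 := by unfold conic conicForm br; ring

theorem conic_self₂ : conic a b c d e b = 0 := by unfold conic conicForm br; ring

theorem conic_self₃ : conic a b c d e c = 0 := by unfold conic conicForm br; ring

theorem conic_self₄ : conic a b c d e d = 0 := by unfold conic conicForm br; ring

theorem conic_self₅ : conic a b c d e e = 0 := by unfold conic conicForm br; ring

theorem conicPolar_self₁₃ : conicPolar a b c d e a c =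
    br a b c * br a c d * br a c e * br b d e := by
  unfold conicPolar conicForm br; ring

theorem conicPolar_self₁₅ : conicPolar a b c d e a e =
    br a b e * br a c e * br a d e * br b c d := by
  unfold conicPolar conicForm br; ring

theorem conicPolar_self₃₅ : conicPolar a b c d e c e =
    br a c e * br b c e * br c d e * br a b d := by
  unfold conicPolar conicForm br; ring

theorem conicPolar_self₄₅ : conicPolar a b c d e d e =
    br a d e * br b d e * br c d e * br a b c := by
  unfold conicPolar conicForm br; ring

theorem conic_swap₁₂ : conic b a c d e x = -conic a b c d e x := by
  unfold conic conicForm br; ring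

theorem conic_swap₂₃ : conic a c b d e x = -conic a b c d e x := by
  unfold conic conicForm br; ring

theorem conic_swap₃₄ : conic a b d c e x = -conic a b c d e x := by
  unfold conic conicForm br; ring

theorem conic_swap₄₅ : conic a b c e d x = -conic a b c d e x := by
  unfold conic conicForm br; ring

theorem conic_reverse : conic e d c b a x = conic a b c d e x := by
  unfold conic conicForm br; ring

end Conic

/-- Vectors `a, b, c, d, e` of `ℝ³` all of whose ordered brackets are positive. -/
structure PosPentagon (a b c d e : Fin 3 → ℝ) : Prop where
  abc : 0 < br a b c
  abd : 0 < br a b d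
  acd : 0 < br a c d
  bcd : 0 < br b c d
  abe : 0 < br a b e
  ace : 0 < br a c e
  bce : 0 < br b c e
  ade : 0 < br a d e
  bde : 0 < br b d e
  cde : 0 < br c d e

/-- `o` extends the pentagon `a, b, c, d, e` to a convex hexagon `o, a, b, c, d, e` and lies
inside the conic through `a, b, c, d, e`. -/
structure InnerVertex (a b c d e o : Fin 3 → ℝ) : Prop where
  ac : 0 < br a c o
  ce : 0 < br c e o
  ae : 0 < br a e o
  ab : 0 < br a b o
  de : 0 < br d e o
  inside : 0 < conic a b c d e o

/-- `x` extends the hexagon `o, a, b, c, d, e` to a convex heptagon `o, a, b, c, d, e, x` and lies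
outside the conic through `a, b, c, d, e`. -/
structure OuterVertex (a b c d e o x : Fin 3 → ℝ) : Prop where
  oa : 0 < br o a x
  de : 0 < br d e x
  oe : 0 < br o e x
  outside : conic a b c d e x < 0

theorem exists_forall_mul_lt {u₁ u₂ u₃ v₁ v₂ v₃ : ℝ} (h₁ : 0 < v₁) (h₂ : 0 < v₂) (h₃ : 0 < v₃) :
    ∃ ε : ℝ, 0 < ε ∧ ε < 1 ∧ ε * u₁ < v₁ ∧ ε * u₂ < v₂ ∧ ε * u₃ < v₃ := by
  have key : ∀ {u v : ℝ}, 0 < v → ∀ᶠ ε in nhdsWithin (0 : ℝ) (Set.Ioi 0), ε * u < v := by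
    intro u v hv
    have h : Filter.Tendsto (fun ε : ℝ => ε * u) (nhdsWithin 0 (Set.Ioi 0)) (nhds (0 * u)) :=
      (Continuous.tendsto (by fun_prop) 0).mono_left nhdsWithin_le_nhds
    rw [zero_mul] at h
    exact h.eventually (gt_mem_nhds hv)
  have hpos : ∀ᶠ ε in nhdsWithin (0 : ℝ) (Set.Ioi 0), (0 : ℝ) < ε := self_mem_nhdsWithin
  obtain ⟨ε, ⟨⟨⟨h0, h01⟩, h1⟩, h2⟩, h3⟩ :=
    ((((hpos.and (key (u := 1) one_pos)).and (key (u := u₁) h₁)).and (key (u := u₂) h₂)).and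
      (key (u := u₃) h₃)).exists
  exact ⟨ε, h0, by simpa using h01, h1, h2, h3⟩

section Pentagon

variable {a b c d e : Fin 3 → ℝ}

theorem PosPentagon.polar_ac_pos (h : PosPentagon a b c d e) : 0 < conicPolar a b c d e a c := by
  rw [conicPolar_self₁₃]
  exact mul_pos (mul_pos (mul_pos h.abc h.acd) h.ace) h.bde

theorem PosPentagon.polar_ae_pos (h : PosPentagon a b c d e) : 0 < conicPolar a b c d e a e := by
  rw [conicPolar_self₁₅]
  exact mul_pos (mul_pos (mul_pos h.abe h.ace) h.ade) h.bcd

theorem PosPentagon.polar_ce_pos (h : PosPentagon a b c d e) : 0 < conicPolar a b c d e c e := by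
  rw [conicPolar_self₃₅]
  exact mul_pos (mul_pos (mul_pos h.ace h.bce) h.cde) h.abd

theorem PosPentagon.polar_de_pos (h : PosPentagon a b c d e) : 0 < conicPolar a b c d e d e := by
  rw [conicPolar_self₄₅]
  exact mul_pos (mul_pos (mul_pos h.ade h.bde) h.cde) h.abc

/-- The coordinates of a vector in the basis `a, c, e` (up to the factor `br a c e`). -/
theorem smul_eq_ace (x : Fin 3 → ℝ) :
    br a c e • x = br c e x • a - br a e x • c + br a c x • e := by
  rw [br_cramer a c e x, br_swap_right a e x, br_rotate c e x |>.symm, br_rotate e x c]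
  module

theorem conicPolar_ace (x y : Fin 3 → ℝ) :
    br a c e ^ 2 * conicPolar a b c d e x y =
      (br c e x * br a c y + br a c x * br c e y) * conicPolar a b c d e a e
      - (br a c x * br a e y + br a e x * br a c y) * conicPolar a b c d e c e
      - (br c e x * br a e y + br a e x * br c e y) * conicPolar a b c d e a c := by
  have h : br a c e ^ 2 * conicPolar a b c d e x y =
      conicPolar a b c d e (br a c e • x) (br a c e • y) := by
    rw [conicPolar_smul_left, conicPolar_smul_right]; ring
  have hd : ∀ x, conicPolar a b c d e x x = 2 * conic a b c d e x := by
    intro x; unfold conicPolar conic; ring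
  rw [h, smul_eq_ace x, smul_eq_ace y]
  simp only [sub_eq_add_neg, ← neg_smul, conicPolar_add_left, conicPolar_add_right,
    conicPolar_smul_left, conicPolar_smul_right, hd, conic_self₁, conic_self₃, conic_self₅]
  rw [conicPolar_comm a b c d e c a, conicPolar_comm a b c d e e a,
    conicPolar_comm a b c d e e c]
  ring

theorem conic_ace (x : Fin 3 → ℝ) :
    br a c e ^ 2 * conic a b c d e x =
      br c e x * br a c x * conicPolar a b c d e a e
      - br a c x * br a e x * conicPolar a b c d e c e
      - br c e x * br a e x * conicPolar a b c d e a c := by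
  have h := conicPolar_ace (a := a) (b := b) (c := c) (d := d) (e := e) x x
  have hd : conicPolar a b c d e x x = 2 * conic a b c d e x := by
    unfold conicPolar conic; ring
  rw [hd] at h
  linarith

/-- A reverse Cauchy-Schwarz inequality in coordinates. -/
theorem polar_nonneg_aux {α β γ α' β' γ' p q r : ℝ} (hα : 0 < α) (hβ : 0 < β)
    (hα' : 0 < α') (hβ' : 0 < β') (hp : 0 < p) (hq : 0 < q) (hr : 0 < r)
    (h : 0 < β * α * p - α * γ * q - β * γ * r)
    (h' : 0 < β' * α' * p - α' * γ' * q - β' * γ' * r) :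
    0 ≤ (β * α' + α * β') * p - (α * γ' + γ * α') * q - (β * γ' + γ * β') * r := by
  set l := α * q + β * r with hl
  set l' := α' * q + β' * r with hl'
  have hl0 : 0 < l := by positivity
  have hl0' : 0 < l' := by positivity
  have h1 : γ * l < β * α * p := by rw [hl]; linarith
  have h1' : γ' * l' < β' * α' * p := by rw [hl']; linarith
  have h2 : γ * l * l' ^ 2 ≤ β * α * p * l' ^ 2 := by gcongr
  have h2' : γ' * l' * l ^ 2 ≤ β' * α' * p * l ^ 2 := by gcongr
  have key : (l' * α - l * α') * (l' * β - l * β') = -(q * r * (α' * β - β' * α) ^ 2) := by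
    rw [hl, hl']; ring
  have key' : p * ((l' * α - l * α') * (l' * β - l * β')) ≤ 0 := by
    rw [key]
    have : 0 ≤ p * (q * r * (α' * β - β' * α) ^ 2) := by positivity
    linarith
  refine (mul_nonneg_iff_of_pos_left (mul_pos hl0 hl0')).mp ?_
  have : l * l' * ((β * α' + α * β') * p - (α * γ' + γ * α') * q - (β * γ' + γ * β') * r) =
      (β * α * p * l' ^ 2 - γ * l * l' ^ 2) + (β' * α' * p * l ^ 2 - γ' * l' * l ^ 2)
      - p * ((l' * α - l * α') * (l' * β - l * β')) := by
    rw [hl, hl']; ring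
  rw [this]
  linarith

theorem InnerVertex.polar_nonneg (h : PosPentagon a b c d e) {x y : Fin 3 → ℝ}
    (hx : InnerVertex a b c d e x) (hy : InnerVertex a b c d e y) :
    0 ≤ conicPolar a b c d e x y := by
  have hace := h.ace
  refine (mul_nonneg_iff_of_pos_left (pow_pos hace 2)).mp ?_
  rw [conicPolar_ace]
  refine polar_nonneg_aux hx.ac hx.ce hy.ac hy.ce h.polar_ae_pos h.polar_ce_pos h.polar_ac_pos
    ?_ ?_
  · rw [← conic_ace]; exact mul_pos (by positivity) hx.inside
  · rw [← conic_ace]; exact mul_pos (by positivity) hy.inside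

theorem convex_innerVertex (h : PosPentagon a b c d e) :
    Convex ℝ {o | InnerVertex a b c d e o} := by
  rw [convex_iff_forall_pos]
  intro x hx y hy s t hs ht _
  have hB := InnerVertex.polar_nonneg h hx hy
  obtain ⟨h1, h2, h3, h4, h5, h6⟩ := hx
  obtain ⟨k1, k2, k3, k4, k5, k6⟩ := hy
  constructor
  all_goals
    simp only [br_add_right, br_smul_right, conic_add, conic_smul, conicPolar_smul_left,
      conicPolar_smul_right]
    positivity

theorem exists_innerVertex (h : PosPentagon a b c d e) : ∃ o, InnerVertex a b c d e o := by
  obtain ⟨ε, h0, -, h1, h2, h3⟩ := exists_forall_mul_lt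
    (u₁ := br a b c) (u₂ := br c d e)
    (u₃ := conicPolar a b c d e a c + conicPolar a b c d e c e) h.abe h.ade h.polar_ae_pos
  have hace := h.ace
  refine ⟨a + e + (-ε) • c, ?_, ?_, ?_, ?_, ?_, ?_⟩
  · simp only [br_add_right, br_smul_right, br_self_outer, br_self_right]
    linarith
  · simp only [br_add_right, br_smul_right, br_self_outer, br_self_right, br_rotate]
    rw [← br_rotate]
    linarith [br_rotate a c e]
  · simp only [br_add_right, br_smul_right, br_self_outer, br_self_right]
    rw [br_swap_right a c e]
    nlinarith
  · simp only [br_add_right, br_smul_right, br_self_outer]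
    linarith
  · simp only [br_add_right, br_smul_right, br_self_right]
    have e1 : br d e a = br a d e := br_rotate a d e
    have e2 : br d e c = br c d e := br_rotate c d e
    rw [e1, e2]
    linarith
  · simp only [conic_add, conic_smul, conicPolar_add_left, conicPolar_smul_right, conic_self₁,
      conic_self₃, conic_self₅]
    rw [conicPolar_comm a b c d e e c]
    linarith

/-- The positivity of all the brackets of a vector `o` with two ordered vertices of the pentagon
`a, b, c, d, e`. -/
structure PosHexagon (a b c d e o : Fin 3 → ℝ) : Prop where
  ab : 0 < br a b o
  ac : 0 < br a c o
  ad : 0 < br a d o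
  ae : 0 < br a e o
  bc : 0 < br b c o
  bd : 0 < br b d o
  be : 0 < br b e o
  cd : 0 < br c d o
  ce : 0 < br c e o
  de : 0 < br d e o

theorem InnerVertex.posHexagon (h : PosPentagon a b c d e) {o : Fin 3 → ℝ}
    (ho : InnerVertex a b c d e o) : PosHexagon a b c d e o := by
  have key : ∀ u w, 0 < br c e o * br u w a - br a e o * br u w c + br a c o * br u w e →
      0 < br u w o := by
    intro u w huw
    have h1 := congrArg (br u w) (smul_eq_ace (a := a) (c := c) (e := e) o)
    simp only [sub_eq_add_neg, ← neg_smul, br_add_right, br_smul_right] at h1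
    refine (mul_pos_iff_of_pos_left h.ace).mp ?_
    linarith
  have r : ∀ u v w, br v w u = br u v w := br_rotate
  have s : ∀ u v w, br u w v = -br u v w := br_swap_right
  have h1 := ho.ac
  have h2 := ho.ce
  have h3 := ho.ae
  have g1 := h.abc
  have g2 := h.abd
  have g3 := h.acd
  have g4 := h.bcd
  have g5 := h.abe
  have g6 := h.ace
  have g7 := h.bce
  have g8 := h.ade
  have g9 := h.bde
  have g10 := h.cde
  refine ⟨ho.ab, ho.ac, key _ _ ?_, ho.ae, key _ _ ?_, key _ _ ?_, key _ _ ?_, key _ _ ?_, ho.ce,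
    ho.de⟩
  · rw [br_self_outer, s a c d]
    nlinarith [mul_pos h3 g3, mul_pos h1 g8]
  · rw [br_self_right, r a b c]
    nlinarith [mul_pos h2 g1, mul_pos h1 g7]
  · rw [r a b d, s b c d]
    nlinarith [mul_pos h2 g2, mul_pos h1 g9, mul_pos h3 g4]
  · rw [r a b e, s b c e, br_self_right]
    nlinarith [mul_pos h2 g5, mul_pos h3 g7]
  · rw [r a c d, br_self_outer]
    nlinarith [mul_pos h2 g3, mul_pos h1 g10]

theorem InnerVertex.polar_e_nonneg (h : PosPentagon a b c d e) {o : Fin 3 → ℝ}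
    (ho : InnerVertex a b c d e o) : 0 ≤ conicPolar a b c d e o e := by
  have hace := h.ace
  have h1 := conicPolar_ace (a := a) (b := b) (c := c) (d := d) (e := e) o e
  have h2 := conic_ace (a := a) (b := b) (c := c) (d := d) (e := e) o
  rw [br_self_right, br_self_right] at h1
  have h3 := mul_pos (pow_pos hace 2) ho.inside
  rw [h2] at h3
  have h4 := mul_pos (mul_pos ho.ce ho.ae) h.polar_ac_pos
  have h5 : 0 < br a c o * (br c e o * conicPolar a b c d e a e -
      br a e o * conicPolar a b c d e c e) := by linarith
  have h6 := mul_pos hace ((mul_pos_iff_of_pos_left ho.ac).mp h5)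
  refine (mul_nonneg_iff_of_pos_left (pow_pos hace 2)).mp ?_
  linarith

end Pentagon

/-- The intersection point of the lines `o a` and `d e`. -/
def apex (o a d e : Fin 3 → ℝ) : Fin 3 → ℝ := br a d e • o + (-br o d e) • a

theorem apex_eq (o a d e : Fin 3 → ℝ) :
    apex o a d e = br o a d • e + (-br o a e) • d := by
  funext i
  fin_cases i <;> simp [apex, br] <;> ring

theorem smul_eq_apex (o a d e x : Fin 3 → ℝ) :
    (br o d e * br o a e) • x =
      (br o a e * br d e x) • o + (br o d e * br o a x) • e + br o e x • apex o a d e := by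
  have h := br_cramer o e (apex o a d e) x
  have h1 : br o e (apex o a d e) = br o d e * br o a e := by
    rw [apex, br_add_right, br_smul_right, br_smul_right, br_self_outer, br_swap_right o a e]
    ring
  have h2 : br x e (apex o a d e) = br o a e * br d e x := by
    rw [apex_eq, br_add_right, br_smul_right, br_smul_right, br_self_right, br_swap_right x d e,
      ← br_rotate x d e]
    ring
  have h3 : br o x (apex o a d e) = br o d e * br o a x := by
    rw [apex, br_add_right, br_smul_right, br_smul_right, br_self_outer, br_swap_right o a x]
    ring
  rw [h1, h2, h3] at h
  exact h

section Hexagon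

variable {o a b c d e x : Fin 3 → ℝ}

theorem conic_apex_neg (h : PosPentagon a b c d e) (ho : PosHexagon a b c d e o) :
    conic a b c d e (apex o a d e) < 0 := by
  rw [apex_eq, conic_add, conic_smul, conic_smul, conic_self₄, conic_self₅, conicPolar_smul_left,
    conicPolar_smul_right, conicPolar_comm, br_rotate o a d |>.symm, br_rotate o a e |>.symm]
  have := mul_pos (mul_pos ho.ad ho.ae) h.polar_de_pos
  linarith

theorem OuterVertex.polar_apex_neg (h : PosPentagon a b c d e) (ho : InnerVertex a b c d e o)
    (hx : OuterVertex a b c d e o x) : conicPolar a b c d e x (apex o a d e) < 0 := by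
  have hA := conic_apex_neg h (ho.posHexagon h)
  have hs : 0 < br o d e := by rw [← br_rotate]; exact ho.de
  have hv : 0 < br o a e := by rw [← br_rotate]; exact ho.ae
  have h1 : (br o a e * br d e x) • o + (br o d e * br o a x) • e =
      (br o d e * br o a e) • x + (-br o e x) • apex o a d e := by
    rw [smul_eq_apex]; module
  have h2 := congrArg (conic a b c d e) h1
  rw [conic_add, conic_add] at h2
  simp only [conic_smul, conicPolar_smul_left, conicPolar_smul_right, conic_self₅] at h2
  have hk : 0 ≤ (br o a e * br d e x) ^ 2 * conic a b c d e o +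
      br o d e * br o a x * (br o a e * br d e x * conicPolar a b c d e o e) := by
    have := ho.polar_e_nonneg h
    have := ho.inside
    have := hx.oa
    have := hx.de
    positivity
  have h3 : 0 < br o d e * br o a e := mul_pos hs hv
  have h4 := mul_neg_of_pos_of_neg (pow_pos h3 2) hx.outside
  have h5 := mul_neg_of_pos_of_neg (pow_pos hx.oe 2) hA
  have h6 : br o e x * (br o d e * br o a e) * conicPolar a b c d e x (apex o a d e) < 0 := by
    nlinarith
  exact (pos_iff_neg_of_mul_neg h6).mp (mul_pos hx.oe h3)

theorem br_oe_apex : br o e (apex o a d e) = br o d e * br o a e := by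
  rw [apex, br_add_right, br_smul_right, br_smul_right, br_self_outer, br_swap_right o a e]
  ring

theorem br_oa_apex : br o a (apex o a d e) = 0 := by
  rw [apex, br_add_right, br_smul_right, br_smul_right, br_self_outer, br_self_right]
  ring

theorem br_de_apex : br d e (apex o a d e) = 0 := by
  rw [apex_eq, br_add_right, br_smul_right, br_smul_right, br_self_outer, br_self_right]
  ring

theorem exists_outerVertex (h : PosPentagon a b c d e) (ho : InnerVertex a b c d e o) :
    ∃ x, OuterVertex a b c d e o x := by
  have hA := conic_apex_neg h (ho.posHexagon h)
  have hs : 0 < br o d e := by rw [← br_rotate]; exact ho.de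
  have hv : 0 < br o a e := by rw [← br_rotate]; exact ho.ae
  obtain ⟨ε, h0, h1, h2, -, -⟩ := exists_forall_mul_lt
    (u₁ := |conicPolar a b c d e (apex o a d e) (o + e)| + |conic a b c d e (o + e)|)
    (u₂ := 0) (u₃ := 0) (neg_pos.mpr hA) one_pos one_pos
  refine ⟨apex o a d e + ε • (o + e), ?_, ?_, ?_, ?_⟩
  · simp only [br_add_right, br_smul_right, br_oa_apex, br_self_outer]
    have := mul_pos h0 hv
    linarith
  · simp only [br_add_right, br_smul_right, br_de_apex, br_self_right]
    have := mul_pos h0 hs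
    rw [← br_rotate] at this
    linarith [br_rotate o d e, br_rotate d e o]
  · simp only [br_add_right, br_smul_right, br_oe_apex, br_self_right, br_self_outer]
    have := mul_pos hs hv
    linarith
  · rw [conic_add, conic_smul, conicPolar_smul_right]
    have e1 := le_abs_self (conicPolar a b c d e (apex o a d e) (o + e))
    have e2 := le_abs_self (conic a b c d e (o + e))
    have e3 := abs_nonneg (conic a b c d e (o + e))
    have e4 : ε ^ 2 * conic a b c d e (o + e) ≤ ε * |conic a b c d e (o + e)| := by
      rw [sq, mul_assoc]
      gcongr
      nlinarith
    nlinarith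

theorem OuterVertex.add_apex (h : PosPentagon a b c d e) (ho : InnerVertex a b c d e o)
    (hx : OuterVertex a b c d e o x) {s : ℝ} (hs : 0 ≤ s) :
    OuterVertex a b c d e o (x + s • apex o a d e) := by
  have hA := conic_apex_neg h (ho.posHexagon h)
  have hB := hx.polar_apex_neg h ho
  have h1 : 0 < br o d e := by rw [← br_rotate]; exact ho.de
  have h2 : 0 < br o a e := by rw [← br_rotate]; exact ho.ae
  obtain ⟨k1, k2, k3, k4⟩ := hx
  constructor <;> simp only [br_add_right, br_smul_right, br_oa_apex, br_de_apex, br_oe_apex,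
    conic_add, conic_smul, conicPolar_smul_right]
  · linarith
  · linarith
  · positivity
  · nlinarith [mul_nonneg hs (neg_nonneg.mpr hB.le), mul_nonneg (sq_nonneg s) (neg_nonneg.mpr hA.le)]

theorem isPreconnected_outerVertex (h : PosPentagon a b c d e) (ho : InnerVertex a b c d e o) :
    IsPreconnected {x | OuterVertex a b c d e o x} := by
  have hA := conic_apex_neg h (ho.posHexagon h)
  have hs : 0 < br o d e := by rw [← br_rotate]; exact ho.de
  have hv : 0 < br o a e := by rw [← br_rotate]; exact ho.ae
  have up : ∀ x, OuterVertex a b c d e o x → ∀ s : ℝ, 0 ≤ s →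
      JoinedIn {x | OuterVertex a b c d e o x} x (x + s • apex o a d e) := by
    intro x hx s hs
    refine JoinedIn.of_segment_subset ?_
    rw [segment_eq_image']
    rintro _ ⟨t, ht, rfl⟩
    have := hx.add_apex h ho (mul_nonneg ht.1 hs)
    simpa [mul_smul] using this
  rcases Set.eq_empty_or_nonempty {x | OuterVertex a b c d e o x} with he | hne
  · rw [he]; exact isPreconnected_empty
  refine (isPathConnected_iff.mpr ⟨hne, ?_⟩).isConnected.isPreconnected
  intro x hx y hy
  obtain ⟨ε, h0, h1, h2, -, -⟩ := exists_forall_mul_lt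
    (u₁ := |conicPolar a b c d e x y|)
    (u₂ := 0) (u₃ := 0) (neg_pos.mpr hA) one_pos one_pos
  refine ((up x hx ε⁻¹ (by positivity)).trans (JoinedIn.of_segment_subset ?_)).trans
    (up y hy ε⁻¹ (by positivity)).symm
  rintro _ ⟨s, t, hs, ht, hst, rfl⟩
  set κ := ε⁻¹ with hκ
  have hκ1 : 1 ≤ κ := (one_le_inv₀ h0).mpr h1.le
  have hεκ : κ * ε = 1 := inv_mul_cancel₀ h0.ne'
  have hxy : s • (x + κ • apex o a d e) + t • (y + κ • apex o a d e) =
      s • x + t • y + κ • apex o a d e := by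
    have ht' : t = 1 - s := by linarith
    rw [ht']; module
  have hBx := hx.polar_apex_neg h ho
  have hBy := hy.polar_apex_neg h ho
  obtain ⟨k1, k2, k3, k4⟩ := hx
  obtain ⟨l1, l2, l3, l4⟩ := hy
  rw [hxy]
  have hpos : ∀ {u v : ℝ}, 0 < u → 0 < v → 0 < s * u + t * v := by
    intro u v hu hv
    rcases hs.eq_or_lt with rfl | hs
    · rw [zero_add] at hst; subst hst; simpa using hv
    · positivity
  have hκ2 : 0 < κ * (br o d e * br o a e) := by positivity
  constructor <;> simp only [br_add_right, br_smul_right, br_oa_apex, br_de_apex, br_oe_apex,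
    conic_add, conic_smul, conicPolar_smul_right, conicPolar_smul_left, conicPolar_add_left]
  · linarith [hpos k1 l1]
  · linarith [hpos k2 l2]
  · linarith [hpos k3 l3]
  · have e1 := hpos (neg_pos.mpr hBx) (neg_pos.mpr hBy)
    have e2 : 0 ≤ s ^ 2 * -conic a b c d e x := mul_nonneg (sq_nonneg s) (neg_nonneg.mpr k4.le)
    have e3 : 0 ≤ t ^ 2 * -conic a b c d e y := mul_nonneg (sq_nonneg t) (neg_nonneg.mpr l4.le)
    have e4 : s * (t * conicPolar a b c d e x y) ≤ |conicPolar a b c d e x y| := by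
      have hst1 : s * t ≤ 1 := by nlinarith
      have := abs_nonneg (conicPolar a b c d e x y)
      have := le_abs_self (conicPolar a b c d e x y)
      have := mul_nonneg hs ht
      nlinarith
    have e5 : |conicPolar a b c d e x y| ≤ κ * |conicPolar a b c d e x y| :=
      le_mul_of_one_le_left (abs_nonneg _) hκ1
    have e6 : κ * |conicPolar a b c d e x y| = κ ^ 2 * (ε * |conicPolar a b c d e x y|) := by
      linear_combination -κ * |conicPolar a b c d e x y| * hεκ
    have e7 : κ ^ 2 * (ε * |conicPolar a b c d e x y|) < κ ^ 2 * -conic a b c d e (apex o a d e) :=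
      mul_lt_mul_of_pos_left h2 (by positivity)
    nlinarith

end Hexagon

/-- The seven vectors `p 0, …, p 6` have positive ordered brackets, and the conic through
`p 1, …, p 5` has `p 0` in its interior and `p 6` in its exterior. -/
structure Heptagon (p : Fin 7 → Fin 3 → ℝ) : Prop where
  br_pos : ∀ i j k, i < j → j < k → 0 < br (p i) (p j) (p k)
  inside : 0 < conic (p 1) (p 2) (p 3) (p 4) (p 5) (p 0)
  outside : conic (p 1) (p 2) (p 3) (p 4) (p 5) (p 6) < 0

section

variable {o a b c d e x : Fin 3 → ℝ}

theorem OuterVertex.br_pos_of_br_apex_pos (ho : PosHexagon a b c d e o)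
    (hx : OuterVertex a b c d e o x) {u w : Fin 3 → ℝ} (huo : 0 ≤ br u w o) (hue : 0 ≤ br u w e)
    (huA : 0 < br u w (apex o a d e)) : 0 < br u w x := by
  have hs : 0 < br o d e := by rw [← br_rotate]; exact ho.de
  have hv : 0 < br o a e := by rw [← br_rotate]; exact ho.ae
  have h := congrArg (br u w) (smul_eq_apex o a d e x)
  simp only [br_add_right, br_smul_right] at h
  refine (mul_pos_iff_of_pos_left (mul_pos hs hv)).mp ?_
  rw [h]
  have := hx.oa
  have := hx.de
  have := hx.oe
  positivity

theorem OuterVertex.posHexagon (h : PosPentagon a b c d e) (ho : PosHexagon a b c d e o)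
    (hx : OuterVertex a b c d e o x) : PosHexagon a b c d e x := by
  have r : ∀ u v w, br v w u = br u v w := br_rotate
  have s : ∀ u v w, br u w v = -br u v w := br_swap_right
  obtain ⟨h1, h2, h3, h4, h5, h6, h7, h8, h9, h10⟩ := h
  have ho' := ho
  obtain ⟨k1, k2, k3, k4, k5, k6, k7, k8, k9, k10⟩ := ho
  rw [r] at k1 k2 k3 k4 k5 k6 k7 k8 k9 k10
  have key : ∀ {u w : Fin 3 → ℝ}, 0 ≤ br o u w → 0 ≤ br u w e →
    0 < br u w (apex o a d e) → 0 < br u w x := fun h1 h2 h3 =>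
      hx.br_pos_of_br_apex_pos ho' (by rwa [r]) h2 h3
  have ab : 0 < br a b (apex o a d e) := by
    simp only [apex, br_add_right, br_smul_right, r o a b, br_self_outer]
    have := mul_pos h8 k1
    linarith
  have ac : 0 < br a c (apex o a d e) := by
    simp only [apex, br_add_right, br_smul_right, r o a c, br_self_outer]
    have := mul_pos h8 k2
    linarith
  have ad : 0 < br a d (apex o a d e) := by
    simp only [apex, br_add_right, br_smul_right, r o a d, br_self_outer]
    have := mul_pos h8 k3
    linarith
  have ae : 0 < br a e (apex o a d e) := by
    simp only [apex, br_add_right, br_smul_right, r o a e, br_self_outer]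
    have := mul_pos h8 k4
    linarith
  have be : 0 < br b e (apex o a d e) := by
    simp only [apex_eq, br_add_right, br_smul_right, br_self_right, s b d e]
    have := mul_pos k4 h9
    linarith
  have ce : 0 < br c e (apex o a d e) := by
    simp only [apex_eq, br_add_right, br_smul_right, br_self_right, s c d e]
    have := mul_pos k4 h10
    linarith
  have bd : 0 < br b d (apex o a d e) := by
    simp only [apex_eq, br_add_right, br_smul_right, br_self_right]
    have := mul_pos k3 h9
    linarith
  have cd : 0 < br c d (apex o a d e) := by
    simp only [apex_eq, br_add_right, br_smul_right, br_self_right]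
    have := mul_pos k3 h10
    linarith
  have ob : 0 < br o b (apex o a d e) := by
    simp only [apex, br_add_right, br_smul_right, br_self_outer, s o a b]
    have := mul_pos k10 k1
    linarith
  have bc : 0 < br b c (apex o a d e) := by
    have e1 := br_plucker b c e o (apex o a d e)
    rw [r o b c, r o b e, br_swap o b] at e1
    refine (mul_pos_iff_of_pos_left k7).mp ?_
    have := mul_pos k5 be
    have := mul_pos h7 ob
    linarith
  exact ⟨key k1.le h5.le ab, key k2.le h6.le ac, key k3.le h8.le ad,
    key k4.le (br_self_right _ _).ge ae, key k5.le h7.le bc, key k6.le h9.le bd,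
    key k7.le (br_self_right _ _).ge be, key k8.le h10.le cd,
    key k9.le (br_self_right _ _).ge ce, hx.de⟩

theorem OuterVertex.heptagon (h : PosPentagon a b c d e) (ho : InnerVertex a b c d e o)
    (hx : OuterVertex a b c d e o x) : Heptagon ![o, a, b, c, d, e, x] := by
  have hH := ho.posHexagon h
  have hH' := hx.posHexagon h hH
  have ob : 0 < br o b x := by
    refine hx.br_pos_of_br_apex_pos hH (br_self_outer _ _).ge ?_ ?_
    · rw [← br_rotate]; exact hH.be.le
    · simp only [apex, br_add_right, br_smul_right, br_self_outer, br_swap_right o a b]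
      have := mul_pos hH.de hH.ab
      rw [br_rotate o d e, br_rotate o a b] at this
      linarith
  have oc : 0 < br o c x := by
    refine hx.br_pos_of_br_apex_pos hH (br_self_outer _ _).ge ?_ ?_
    · rw [← br_rotate]; exact hH.ce.le
    · simp only [apex, br_add_right, br_smul_right, br_self_outer, br_swap_right o a c]
      have := mul_pos hH.de hH.ac
      rw [br_rotate o d e, br_rotate o a c] at this
      linarith
  have od : 0 < br o d x := by
    refine hx.br_pos_of_br_apex_pos hH (br_self_outer _ _).ge ?_ ?_
    · rw [← br_rotate]; exact hH.de.le
    · simp only [apex, br_add_right, br_smul_right, br_self_outer, br_swap_right o a d]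
      have := mul_pos hH.de hH.ad
      rw [br_rotate o d e, br_rotate o a d] at this
      linarith
  refine ⟨?_, ho.inside, hx.outside⟩
  intro i j k hij hjk
  obtain ⟨h1, h2, h3, h4, h5, h6, h7, h8, h9, h10⟩ := h
  obtain ⟨k1, k2, k3, k4, k5, k6, k7, k8, k9, k10⟩ := hH
  obtain ⟨l1, l2, l3, l4, l5, l6, l7, l8, l9, l10⟩ := hH'
  have := hx.oa
  have := hx.oe
  simp only [br_rotate o] at k1 k2 k3 k4 k5 k6 k7 k8 k9 k10
  fin_cases i <;> fin_cases j <;> first | exact absurd hij (by decide) | skip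
  all_goals fin_cases k <;> first | exact absurd hjk (by decide) | assumption

end

variable {p : Fin 7 → Fin 3 → ℝ}

theorem Heptagon.posPentagon (h : Heptagon p) : PosPentagon (p 1) (p 2) (p 3) (p 4) (p 5) := by
  constructor <;> exact h.br_pos _ _ _ (by decide) (by decide)

theorem Heptagon.innerVertex (h : Heptagon p) :
    InnerVertex (p 1) (p 2) (p 3) (p 4) (p 5) (p 0) := by
  refine ⟨?_, ?_, ?_, ?_, ?_, h.inside⟩ <;> rw [br_rotate] <;>
    exact h.br_pos _ _ _ (by decide) (by decide)

theorem Heptagon.outerVertex (h : Heptagon p) :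
    OuterVertex (p 1) (p 2) (p 3) (p 4) (p 5) (p 0) (p 6) := by
  refine ⟨?_, ?_, ?_, h.outside⟩ <;> exact h.br_pos _ _ _ (by decide) (by decide)

/-- An open subset of a product is connected as soon as it projects onto a connected set with
connected fibres. -/
theorem IsOpen.isConnected_of_fibres {X Y : Type*} [TopologicalSpace X] [TopologicalSpace Y]
    {S : Set (X × Y)} {T : Set X} (hS : IsOpen S) (hT : IsConnected T)
    (hST : ∀ z ∈ S, z.1 ∈ T) (hne : ∀ x ∈ T, ∃ y, (x, y) ∈ S)
    (hfib : ∀ x ∈ T, IsPreconnected {y | (x, y) ∈ S}) : IsConnected S := by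
  obtain ⟨x₀, hx₀⟩ := hT.nonempty
  refine ⟨(hne x₀ hx₀).imp' (fun y => (x₀, y)) fun _ => id, ?_⟩
  rintro U V hU hV hUV ⟨u, huS, huU⟩ ⟨v, hvS, hvV⟩
  obtain ⟨x, hxT, ⟨⟨x', y⟩, ⟨hyS, hyU⟩, rfl⟩, ⟨⟨x'', y'⟩, ⟨hyS', hyV'⟩, hxx⟩⟩ :=
    hT.isPreconnected (Prod.fst '' (S ∩ U)) (Prod.fst '' (S ∩ V))
      (isOpenMap_fst _ (hS.inter hU)) (isOpenMap_fst _ (hS.inter hV))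
      (by
        intro x hx
        obtain ⟨y, hy⟩ := hne x hx
        rcases hUV hy with h | h
        · exact Or.inl ⟨_, ⟨hy, h⟩, rfl⟩
        · exact Or.inr ⟨_, ⟨hy, h⟩, rfl⟩)
      ⟨u.1, hST u huS, u, ⟨huS, huU⟩, rfl⟩ ⟨v.1, hST v hvS, v, ⟨hvS, hvV⟩, rfl⟩
  change x'' = x' at hxx
  subst hxx
  have hc : Continuous fun y : Y => (x'', y) := by fun_prop
  obtain ⟨z, hz, hzU, hzV⟩ := hfib x'' hxT _ _ (hU.preimage hc) (hV.preimage hc)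
    (fun z hz => hUV hz) ⟨y, hyS, hyU⟩ ⟨y', hyS', hyV'⟩
  exact ⟨(x'', z), hz, hzU, hzV⟩

theorem IsPreconnected.setOf_and {X : Type*} [TopologicalSpace X] {P : Prop} {Q : X → Prop}
    (hQ : IsPreconnected {x | Q x}) (h : P) : IsPreconnected {x | P ∧ Q x} := by
  simpa [h] using hQ

section Continuity

variable {X : Type*} [TopologicalSpace X] {a b c d e x : X → Fin 3 → ℝ}

@[fun_prop]
theorem Continuous.br (ha : Continuous a) (hb : Continuous b) (hc : Continuous c) :
    Continuous fun t => br (a t) (b t) (c t) := by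
  unfold _root_.br; fun_prop

@[fun_prop]
theorem Continuous.conic (ha : Continuous a) (hb : Continuous b) (hc : Continuous c)
    (hd : Continuous d) (he : Continuous e) (hx : Continuous x) :
    Continuous fun t => conic (a t) (b t) (c t) (d t) (e t) (x t) := by
  unfold _root_.conic conicForm; fun_prop

end Continuity

theorem convex_setOf_br_pos (a b : Fin 3 → ℝ) : Convex ℝ {x | 0 < br a b x} :=
  convex_halfSpace_gt ⟨br_add_right a b, fun s x => br_smul_right a b x s⟩ 0

theorem br_eq_crossProduct (a b c : Fin 3 → ℝ) :
    br a b c = dotProduct (crossProduct a b) c := by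
  simp [br, crossProduct, Fin.sum_univ_three, dotProduct]; ring

theorem isConnected_setOf_crossProduct_ne_zero :
    IsConnected {q : (Fin 3 → ℝ) × (Fin 3 → ℝ) | crossProduct q.1 q.2 ≠ 0} := by
  have hopen : IsOpen {q : (Fin 3 → ℝ) × (Fin 3 → ℝ) | crossProduct q.1 q.2 ≠ 0} := by
    refine isOpen_ne_fun ?_ continuous_const
    simp only [cross_apply]
    refine continuous_pi fun i => ?_
    fin_cases i <;> simp <;> fun_prop
  have hfin : 1 < Module.rank ℝ (Fin 3 → ℝ) := by simp
  have hfib : ∀ a : Fin 3 → ℝ, a ≠ 0 →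
      {b : Fin 3 → ℝ | crossProduct a b ≠ 0} = (Submodule.span ℝ {a} : Set (Fin 3 → ℝ))ᶜ := by
    intro a ha
    ext b
    rw [Set.mem_ofPred_eq, crossProduct_ne_zero_iff_linearIndependent,
      LinearIndependent.pair_iff' ha, Set.mem_compl_iff, SetLike.mem_coe,
      Submodule.mem_span_singleton, not_exists]
  have hconn : ∀ a : Fin 3 → ℝ, a ≠ 0 → IsConnected {b : Fin 3 → ℝ | crossProduct a b ≠ 0} := by
    intro a ha
    rw [hfib a ha]
    refine isConnected_compl_of_one_lt_codim ?_
    have h := Submodule.finrank_quotient_add_finrank (Submodule.span ℝ {a})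
    rw [finrank_span_singleton ha, Module.finrank_fin_fun] at h
    rw [← Module.finrank_eq_rank]
    have h2 : Module.finrank ℝ ((Fin 3 → ℝ) ⧸ Submodule.span ℝ {a}) = 2 := by omega
    rw [h2]
    norm_num
  refine hopen.isConnected_of_fibres (isConnected_compl_singleton_of_one_lt_rank hfin 0) ?_
    (fun a ha => (hconn a ha).nonempty) (fun a ha => (hconn a ha).isPreconnected)
  rintro ⟨a, b⟩ h rfl
  exact h (by simp)

theorem isConnected_setOf_br_pos :
    IsConnected {q : ((Fin 3 → ℝ) × (Fin 3 → ℝ)) × (Fin 3 → ℝ) | 0 < br q.1.1 q.1.2 q.2} := by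
  refine IsOpen.isConnected_of_fibres (isOpen_lt (by fun_prop) (by fun_prop))
    isConnected_setOf_crossProduct_ne_zero ?_ ?_ ?_
  · rintro ⟨⟨a, b⟩, c⟩ h h0
    change 0 < br a b c at h
    change crossProduct a b = 0 at h0
    rw [br_eq_crossProduct, h0, zero_dotProduct] at h
    exact h.false
  · rintro ⟨a, b⟩ h
    refine ⟨crossProduct a b, ?_⟩
    change 0 < br a b (crossProduct a b)
    rw [br_eq_crossProduct]
    exact lt_of_le_of_ne (Finset.sum_nonneg fun i _ => mul_self_nonneg _)
      (Ne.symm (dotProduct_self_eq_zero.not.mpr h))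
  · rintro ⟨a, b⟩ -
    exact (convex_setOf_br_pos a b).isPreconnected

theorem isConnected_posQuadrilateral :
    IsConnected {q : (((Fin 3 → ℝ) × (Fin 3 → ℝ)) × (Fin 3 → ℝ)) × (Fin 3 → ℝ) |
      0 < br q.1.1.1 q.1.1.2 q.1.2 ∧ 0 < br q.1.1.1 q.1.1.2 q.2 ∧ 0 < br q.1.1.1 q.1.2 q.2 ∧
        0 < br q.1.1.2 q.1.2 q.2} := by
  refine IsOpen.isConnected_of_fibres ?_ isConnected_setOf_br_pos (fun z hz => hz.1) ?_ ?_
  · repeat' first | exact isOpen_lt (by fun_prop) (by fun_prop) | refine IsOpen.and ?_ ?_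
  · rintro ⟨⟨a, b⟩, c⟩ h
    change 0 < br a b c at h
    refine ⟨a - b + c, ?_⟩
    simp only [Set.mem_ofPred_eq, br_add_right, br_sub_right, br_self_outer, br_self_right,
      br_swap_right a b c, br_rotate a b c]
    refine ⟨h, ?_, ?_, ?_⟩ <;> linarith
  · rintro ⟨⟨a, b⟩, c⟩ h
    exact ((convex_setOf_br_pos a b).inter
      ((convex_setOf_br_pos a c).inter (convex_setOf_br_pos b c))).isPreconnected.setOf_and h

theorem isConnected_posPentagon :
    IsConnected {q : ((((Fin 3 → ℝ) × (Fin 3 → ℝ)) × (Fin 3 → ℝ)) × (Fin 3 → ℝ)) × (Fin 3 → ℝ) |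
      PosPentagon q.1.1.1.1 q.1.1.1.2 q.1.1.2 q.1.2 q.2} := by
  have hiff : ∀ a b c d e : Fin 3 → ℝ, PosPentagon a b c d e ↔
      (0 < br a b c ∧ 0 < br a b d ∧ 0 < br a c d ∧ 0 < br b c d) ∧ 0 < br a b e ∧ 0 < br a c e ∧
        0 < br b c e ∧ 0 < br a d e ∧ 0 < br b d e ∧ 0 < br c d e := by
    intro a b c d e
    constructor
    · rintro ⟨h1, h2, h3, h4, h5, h6, h7, h8, h9, h10⟩
      exact ⟨⟨h1, h2, h3, h4⟩, h5, h6, h7, h8, h9, h10⟩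
    · rintro ⟨⟨h1, h2, h3, h4⟩, h5, h6, h7, h8, h9, h10⟩
      exact ⟨h1, h2, h3, h4, h5, h6, h7, h8, h9, h10⟩
  simp only [hiff]
  refine IsOpen.isConnected_of_fibres ?_ isConnected_posQuadrilateral (fun z hz => hz.1) ?_ ?_
  · repeat' first | exact isOpen_lt (by fun_prop) (by fun_prop) | refine IsOpen.and ?_ ?_
  · rintro ⟨⟨⟨a, b⟩, c⟩, d⟩ h
    refine ⟨(2 * br a b c) • d + br a b d • (a - c), ?_⟩
    obtain ⟨h1, h2, h3, h4⟩ := h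
    simp only at h1 h2 h3 h4
    have h5 := br_rotate a c d
    have h6 := br_rotate a b d
    have h7 := br_rotate a b c
    have p1 := mul_pos h1 h2
    have p2 := mul_pos h1 h3
    have p3 := mul_pos h1 h4
    have p4 := mul_pos h2 h3
    have p5 := mul_pos h2 h4
    have p6 := mul_pos h2 h2
    simp only [Set.mem_ofPred_eq, br_add_right, br_smul_right, br_sub_right, br_self_outer,
      br_self_right, br_swap_right a c d, br_swap_right b c d, h5, h6, h7]
    refine ⟨⟨h1, h2, h3, h4⟩, ?_, ?_, ?_, ?_, ?_, ?_⟩ <;> nlinarith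
  · rintro ⟨⟨⟨a, b⟩, c⟩, d⟩ h
    exact ((convex_setOf_br_pos a b).inter
      ((convex_setOf_br_pos a c).inter ((convex_setOf_br_pos b c).inter
      ((convex_setOf_br_pos a d).inter ((convex_setOf_br_pos b d).inter
      (convex_setOf_br_pos c d)))))).isPreconnected.setOf_and h

theorem isOpen_posPentagon {X : Type*} [TopologicalSpace X] {a b c d e : X → Fin 3 → ℝ}
    (ha : Continuous a) (hb : Continuous b) (hc : Continuous c) (hd : Continuous d)
    (he : Continuous e) : IsOpen {t | PosPentagon (a t) (b t) (c t) (d t) (e t)} := by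
  have : {t | PosPentagon (a t) (b t) (c t) (d t) (e t)} = {t | 0 < br (a t) (b t) (c t) ∧
      0 < br (a t) (b t) (d t) ∧ 0 < br (a t) (c t) (d t) ∧ 0 < br (b t) (c t) (d t) ∧
      0 < br (a t) (b t) (e t) ∧ 0 < br (a t) (c t) (e t) ∧ 0 < br (b t) (c t) (e t) ∧
      0 < br (a t) (d t) (e t) ∧ 0 < br (b t) (d t) (e t) ∧ 0 < br (c t) (d t) (e t)} := by
    ext t
    constructor
    · rintro ⟨h1, h2, h3, h4, h5, h6, h7, h8, h9, h10⟩
      exact ⟨h1, h2, h3, h4, h5, h6, h7, h8, h9, h10⟩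
    · rintro ⟨h1, h2, h3, h4, h5, h6, h7, h8, h9, h10⟩
      exact ⟨h1, h2, h3, h4, h5, h6, h7, h8, h9, h10⟩
  rw [this]
  repeat' first | exact isOpen_lt (by fun_prop) (by fun_prop) | refine IsOpen.and ?_ ?_

theorem isOpen_innerVertex {X : Type*} [TopologicalSpace X] {a b c d e o : X → Fin 3 → ℝ}
    (ha : Continuous a) (hb : Continuous b) (hc : Continuous c) (hd : Continuous d)
    (he : Continuous e) (ho : Continuous o) :
    IsOpen {t | InnerVertex (a t) (b t) (c t) (d t) (e t) (o t)} := by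
  have : {t | InnerVertex (a t) (b t) (c t) (d t) (e t) (o t)} = {t | 0 < br (a t) (c t) (o t) ∧
      0 < br (c t) (e t) (o t) ∧ 0 < br (a t) (e t) (o t) ∧ 0 < br (a t) (b t) (o t) ∧
      0 < br (d t) (e t) (o t) ∧ 0 < conic (a t) (b t) (c t) (d t) (e t) (o t)} := by
    ext t
    exact ⟨fun ⟨h1, h2, h3, h4, h5, h6⟩ => ⟨h1, h2, h3, h4, h5, h6⟩,
      fun ⟨h1, h2, h3, h4, h5, h6⟩ => ⟨h1, h2, h3, h4, h5, h6⟩⟩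
  rw [this]
  repeat' first | exact isOpen_lt (by fun_prop) (by fun_prop) | refine IsOpen.and ?_ ?_

theorem isOpen_outerVertex {X : Type*} [TopologicalSpace X] {a b c d e o x : X → Fin 3 → ℝ}
    (ha : Continuous a) (hb : Continuous b) (hc : Continuous c) (hd : Continuous d)
    (he : Continuous e) (ho : Continuous o) (hx : Continuous x) :
    IsOpen {t | OuterVertex (a t) (b t) (c t) (d t) (e t) (o t) (x t)} := by
  have : {t | OuterVertex (a t) (b t) (c t) (d t) (e t) (o t) (x t)} =
      {t | 0 < br (o t) (a t) (x t) ∧ 0 < br (d t) (e t) (x t) ∧ 0 < br (o t) (e t) (x t) ∧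
      conic (a t) (b t) (c t) (d t) (e t) (x t) < 0} := by
    ext t
    exact ⟨fun ⟨h1, h2, h3, h4⟩ => ⟨h1, h2, h3, h4⟩, fun ⟨h1, h2, h3, h4⟩ => ⟨h1, h2, h3, h4⟩⟩
  rw [this]
  repeat' first | exact isOpen_lt (by fun_prop) (by fun_prop) | refine IsOpen.and ?_ ?_

theorem isConnected_innerVertex :
    IsConnected {q : (((((Fin 3 → ℝ) × (Fin 3 → ℝ)) × (Fin 3 → ℝ)) × (Fin 3 → ℝ)) ×
      (Fin 3 → ℝ)) × (Fin 3 → ℝ) |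
      PosPentagon q.1.1.1.1.1 q.1.1.1.1.2 q.1.1.1.2 q.1.1.2 q.1.2 ∧
      InnerVertex q.1.1.1.1.1 q.1.1.1.1.2 q.1.1.1.2 q.1.1.2 q.1.2 q.2} := by
  refine IsOpen.isConnected_of_fibres ?_ isConnected_posPentagon (fun z hz => hz.1) ?_ ?_
  · exact (isOpen_posPentagon (by fun_prop) (by fun_prop) (by fun_prop) (by fun_prop)
      (by fun_prop)).inter (isOpen_innerVertex (by fun_prop) (by fun_prop) (by fun_prop)
      (by fun_prop) (by fun_prop) (by fun_prop))
  · rintro ⟨⟨⟨⟨a, b⟩, c⟩, d⟩, e⟩ h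
    exact (exists_innerVertex h).imp fun _ => And.intro h
  · rintro ⟨⟨⟨⟨a, b⟩, c⟩, d⟩, e⟩ h
    exact (convex_innerVertex h).isPreconnected.setOf_and h

theorem isConnected_outerVertex :
    IsConnected {q : ((((((Fin 3 → ℝ) × (Fin 3 → ℝ)) × (Fin 3 → ℝ)) × (Fin 3 → ℝ)) ×
      (Fin 3 → ℝ)) × (Fin 3 → ℝ)) × (Fin 3 → ℝ) |
      (PosPentagon q.1.1.1.1.1.1 q.1.1.1.1.1.2 q.1.1.1.1.2 q.1.1.1.2 q.1.1.2 ∧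
      InnerVertex q.1.1.1.1.1.1 q.1.1.1.1.1.2 q.1.1.1.1.2 q.1.1.1.2 q.1.1.2 q.1.2) ∧
      OuterVertex q.1.1.1.1.1.1 q.1.1.1.1.1.2 q.1.1.1.1.2 q.1.1.1.2 q.1.1.2 q.1.2 q.2} := by
  refine IsOpen.isConnected_of_fibres ?_ isConnected_innerVertex (fun z hz => hz.1) ?_ ?_
  · exact ((isOpen_posPentagon (by fun_prop) (by fun_prop) (by fun_prop) (by fun_prop)
      (by fun_prop)).inter (isOpen_innerVertex (by fun_prop) (by fun_prop) (by fun_prop)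
      (by fun_prop) (by fun_prop) (by fun_prop))).inter (isOpen_outerVertex (by fun_prop)
      (by fun_prop) (by fun_prop) (by fun_prop) (by fun_prop) (by fun_prop) (by fun_prop))
  · rintro ⟨⟨⟨⟨⟨a, b⟩, c⟩, d⟩, e⟩, o⟩ h
    exact (exists_outerVertex h.1 h.2).imp fun _ => And.intro h
  · rintro ⟨⟨⟨⟨⟨a, b⟩, c⟩, d⟩, e⟩, o⟩ h
    exact (isPreconnected_outerVertex h.1 h.2).setOf_and h

/-- Any two heptagons are joined by a path of heptagons. -/
theorem isPathConnected_heptagon : IsPathConnected {p | Heptagon p} := by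
  let F : ((((((Fin 3 → ℝ) × (Fin 3 → ℝ)) × (Fin 3 → ℝ)) × (Fin 3 → ℝ)) × (Fin 3 → ℝ)) ×
      (Fin 3 → ℝ)) × (Fin 3 → ℝ) → Fin 7 → Fin 3 → ℝ := fun q =>
    ![q.1.2, q.1.1.1.1.1.1, q.1.1.1.1.1.2, q.1.1.1.1.2, q.1.1.1.2, q.1.1.2, q.2]
  have hF : Continuous F := by
    refine continuous_pi fun i => ?_
    fin_cases i <;> simp [F] <;> fun_prop
  have himage : {p | Heptagon p} = F '' {q |
      (PosPentagon q.1.1.1.1.1.1 q.1.1.1.1.1.2 q.1.1.1.1.2 q.1.1.1.2 q.1.1.2 ∧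
      InnerVertex q.1.1.1.1.1.1 q.1.1.1.1.1.2 q.1.1.1.1.2 q.1.1.1.2 q.1.1.2 q.1.2) ∧
      OuterVertex q.1.1.1.1.1.1 q.1.1.1.1.1.2 q.1.1.1.1.2 q.1.1.1.2 q.1.1.2 q.1.2 q.2} := by
    ext p
    constructor
    · intro hp
      refine ⟨((((((p 1, p 2), p 3), p 4), p 5), p 0), p 6),
        ⟨⟨hp.posPentagon, hp.innerVertex⟩, hp.outerVertex⟩, ?_⟩
      funext i
      fin_cases i <;> rfl
    · rintro ⟨q, ⟨⟨h1, h2⟩, h3⟩, rfl⟩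
      exact h3.heptagon h1 h2
  have hopen : IsOpen {p | Heptagon p} := by
    have : {p | Heptagon p} = {p | PosPentagon (p 1) (p 2) (p 3) (p 4) (p 5) ∧
        InnerVertex (p 1) (p 2) (p 3) (p 4) (p 5) (p 0) ∧
        OuterVertex (p 1) (p 2) (p 3) (p 4) (p 5) (p 0) (p 6)} := by
      ext p
      refine ⟨fun hp => ⟨hp.posPentagon, hp.innerVertex, hp.outerVertex⟩, ?_⟩
      rintro ⟨h1, h2, h3⟩
      have hp : p = ![p 0, p 1, p 2, p 3, p 4, p 5, p 6] := by
        funext i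
        fin_cases i <;> rfl
      rw [Set.mem_ofPred_eq, hp]
      exact h3.heptagon h1 h2
    rw [this]
    exact (isOpen_posPentagon (by fun_prop) (by fun_prop) (by fun_prop) (by fun_prop)
      (by fun_prop)).inter ((isOpen_innerVertex (by fun_prop) (by fun_prop) (by fun_prop)
      (by fun_prop) (by fun_prop) (by fun_prop)).inter (isOpen_outerVertex (by fun_prop)
      (by fun_prop) (by fun_prop) (by fun_prop) (by fun_prop) (by fun_prop) (by fun_prop)))
  refine hopen.isConnected_iff_isPathConnected.mp ?_
  rw [himage]
  exact isConnected_outerVertex.image F hF.continuousOn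

section Coconic

variable {a b c d e x : Fin 3 → ℝ}

theorem br_mul_br_eq (a b c x y : Fin 3 → ℝ) :
    br a b c * br c x y = br x b c * br a y c - br a x c * br y b c := by
  unfold br; ring

/-- A quadratic form vanishing at six vectors which are not on a common conic is zero. -/
theorem QuadraticForm.eq_zero_of_six {q : QuadraticForm ℝ (Fin 3 → ℝ)}
    (ha : q a = 0) (hb : q b = 0) (hc : q c = 0) (hd : q d = 0) (he : q e = 0) (hx : q x = 0)
    (habc : br a b c ≠ 0)
    (h : br a b x * br c d x * (br a c e * br b d e) ≠
      br a b e * br c d e * (br a c x * br b d x)) : q = 0 := by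
  have expand : ∀ z, br a b c ^ 2 * q z =
      br z b c * br a z c * QuadraticMap.polar q a b +
      br z b c * br a b z * QuadraticMap.polar q a c +
      br a z c * br a b z * QuadraticMap.polar q b c := by
    intro z
    have h1 : q (br a b c • z) = br a b c ^ 2 * q z := by
      rw [QuadraticMap.map_smul, smul_eq_mul, sq]
    rw [← h1, br_cramer a b c z]
    rw [QuadraticMap.map_add q, QuadraticMap.map_add q, QuadraticMap.polar_add_left]
    simp only [QuadraticMap.map_smul, QuadraticMap.polar_smul_left,
      QuadraticMap.polar_smul_right, ha, hb, hc, smul_eq_mul]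
    ring
  have h1 := expand d
  have h2 := expand e
  have h3 := expand x
  rw [hd, mul_zero] at h1
  rw [he, mul_zero] at h2
  rw [hx, mul_zero] at h3
  generalize QuadraticMap.polar q a b = u at *
  generalize QuadraticMap.polar q a c = v at *
  generalize QuadraticMap.polar q b c = w at *
  have f : ∀ y z, br a b c * br b y z = br a b y * br z b c - br y b c * br a b z := by
    intro y z; unfold br; ring
  have g1 := br_mul_br_eq a b c d x
  have g2 := br_mul_br_eq a b c d e
  have g3 := f d x
  have g4 := f d e
  have s1 := br_swap_right a x c
  have s2 := br_swap_right a e c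
  set D := br a b c
  have hΔ : D ^ 2 * (br a b x * br c d x * (br a c e * br b d e) -
      br a b e * br c d e * (br a c x * br b d x)) ≠ 0 :=
    mul_ne_zero (pow_ne_zero 2 habc) (sub_ne_zero.mpr h)
  have hΔ' : D ^ 2 * (br a b x * br c d x * (br a c e * br b d e) -
      br a b e * br c d e * (br a c x * br b d x)) =
      br a b x * (D * br c d x) * (br a c e * (D * br b d e)) -
      br a b e * (D * br c d e) * (br a c x * (D * br b d x)) := by ring
  rw [hΔ', g1, g2, g3, g4, s1, s2] at hΔ
  generalize br d b c = d₁ at *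
  generalize br a d c = d₂ at *
  generalize br a b d = d₃ at *
  generalize br e b c = e₁ at *
  generalize br a e c = e₂ at *
  generalize br a b e = e₃ at *
  generalize br x b c = x₁ at *
  generalize br a x c = x₂ at *
  generalize br a b x = x₃ at *
  have hu : u = 0 := by
    by_contra hne
    refine mul_ne_zero hne hΔ ?_
    linear_combination
      - ((e₁ * e₃) * (x₂ * x₃) - (e₂ * e₃) * (x₁ * x₃)) * h1
      + ((d₁ * d₃) * (x₂ * x₃) - (d₂ * d₃) * (x₁ * x₃)) * h2
      - ((d₁ * d₃) * (e₂ * e₃) - (d₂ * d₃) * (e₁ * e₃)) * h3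
  have hv : v = 0 := by
    by_contra hne
    refine mul_ne_zero hne hΔ ?_
    linear_combination
      ((e₁ * e₂) * (x₂ * x₃) - (e₂ * e₃) * (x₁ * x₂)) * h1
      - ((d₁ * d₂) * (x₂ * x₃) - (d₂ * d₃) * (x₁ * x₂)) * h2
      + ((d₁ * d₂) * (e₂ * e₃) - (d₂ * d₃) * (e₁ * e₂)) * h3
  have hw : w = 0 := by
    by_contra hne
    refine mul_ne_zero hne hΔ ?_
    linear_combination
      - ((e₁ * e₂) * (x₁ * x₃) - (e₁ * e₃) * (x₁ * x₂)) * h1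
      + ((d₁ * d₂) * (x₁ * x₃) - (d₁ * d₃) * (x₁ * x₂)) * h2
      - ((d₁ * d₂) * (e₁ * e₃) - (d₁ * d₃) * (e₁ * e₂)) * h3
  refine QuadraticMap.ext fun z => ?_
  have := expand z
  rw [hu, hv, hw] at this
  have h0 : D ^ 2 * q z = 0 := by linarith
  simpa using (mul_eq_zero.mp h0).resolve_left (pow_ne_zero 2 habc)

end Coconic

/-- A quadratic form vanishing at `a, b, c, d, e` and at a point off their conic is zero. -/
theorem QuadraticForm.eq_zero_of_conic_ne_zero {q : QuadraticForm ℝ (Fin 3 → ℝ)}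
    {a b c d e x : Fin 3 → ℝ} (ha : q a = 0) (hb : q b = 0) (hc : q c = 0) (hd : q d = 0)
    (he : q e = 0) (hx : q x = 0) (hbcd : br b c d ≠ 0) (h : conic a b c d e x ≠ 0) : q = 0 := by
  refine QuadraticForm.eq_zero_of_six hb hc hd he ha hx hbcd fun h' => h ?_
  rw [br_rotate a b d, br_rotate a c e, br_rotate a b c, br_rotate a d e] at h'
  unfold conic conicForm
  linarith

/-- If `o` and `x` lie on different sides of the conic through `i, j, k, l, m`, then a quadratic
form vanishing at `j, k, l, m, o, x` is zero. -/
theorem QuadraticForm.eq_zero_of_separated {q : QuadraticForm ℝ (Fin 3 → ℝ)}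
    {i j k l m o x : Fin 3 → ℝ} (hj : q j = 0) (hk : q k = 0) (hl : q l = 0) (hm : q m = 0)
    (ho : q o = 0) (hx : q x = 0) (hjkl : br j k l ≠ 0)
    (hjlo : 0 < br j l o) (hkmo : 0 < br k m o) (hjlx : 0 < br j l x) (hkmx : 0 < br k m x)
    (h : conic i j k l m o * conic i j k l m x < 0) : q = 0 := by
  refine QuadraticForm.eq_zero_of_six hj hk hl hm ho hx hjkl fun h' => ?_
  have key : conic i j k l m o * (br j l x * br k m x) =
      conic i j k l m x * (br j l o * br k m o) := by
    unfold conic conicForm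
    linear_combination -(br i j l * br i k m) * h'
  have h1 : 0 < br j l x * br k m x := by positivity
  have h2 : 0 < br j l o * br k m o := by positivity
  have h3 : 0 ≤ conic i j k l m x ^ 2 * (br j l o * br k m o) := by positivity
  have h4 := mul_neg_of_neg_of_pos h h1
  have h5 : conic i j k l m o * conic i j k l m x * (br j l x * br k m x) =
      conic i j k l m x ^ 2 * (br j l o * br k m o) := by
    linear_combination conic i j k l m x * key
  linarith

theorem conic_mul_conic_neg_of_separated (a b c d e o x : Fin 3 → ℝ) (ho : 0 < conic a b c d e o)
    (hx : conic a b c d e x < 0) :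
    conic b a c d e o * conic b a c d e x < 0 ∧ conic c a b d e o * conic c a b d e x < 0 ∧
    conic d a b c e o * conic d a b c e x < 0 ∧ conic e a b c d o * conic e a b c d x < 0 := by
  have h := mul_neg_of_pos_of_neg ho hx
  refine ⟨?_, ?_, ?_, ?_⟩
  · rw [conic_swap₁₂ a b, conic_swap₁₂ a b]; linarith
  · rw [conic_swap₁₂ a c, conic_swap₁₂ a c, conic_swap₂₃ a b c, conic_swap₂₃ a b c]; linarith
  · rw [conic_swap₁₂ a d, conic_swap₁₂ a d, conic_swap₂₃ a b d, conic_swap₂₃ a b d,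
      conic_swap₃₄ a b c d, conic_swap₃₄ a b c d]; linarith
  · rw [conic_swap₁₂ a e, conic_swap₁₂ a e, conic_swap₂₃ a b e, conic_swap₂₃ a b e,
      conic_swap₃₄ a b c e, conic_swap₃₄ a b c e, conic_swap₄₅ a b c d e, conic_swap₄₅ a b c d e]
    linarith

/-- Any quadratic form vanishing at six vertices of a heptagon is zero. -/
theorem Heptagon.eq_zero_of_six {p : Fin 7 → Fin 3 → ℝ} (h : Heptagon p)
    {q : QuadraticForm ℝ (Fin 3 → ℝ)} {i : Fin 7} (hq : ∀ j, j ≠ i → q (p j) = 0) : q = 0 := by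
  have hne : ∀ {i j k}, i < j → j < k → br (p i) (p j) (p k) ≠ 0 := fun hij hjk =>
    (h.br_pos _ _ _ hij hjk).ne'
  have h0 : ∀ {j k}, 0 < j → j < k → 0 < br (p j) (p k) (p 0) := fun hj hjk => by
    rw [br_rotate]; exact h.br_pos _ _ _ hj hjk
  have h6 : ∀ {j k}, j < k → k < 6 → 0 < br (p j) (p k) (p 6) := fun hj hjk =>
    h.br_pos _ _ _ hj hjk
  have hin := h.inside
  have hout := h.outside
  obtain ⟨s2, s3, s4, s5⟩ := conic_mul_conic_neg_of_separated _ _ _ _ _ _ _ hin hout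
  have s1 := mul_neg_of_pos_of_neg hin hout
  fin_cases i
  · exact QuadraticForm.eq_zero_of_conic_ne_zero (hq 1 (by decide)) (hq 2 (by decide))
      (hq 3 (by decide)) (hq 4 (by decide)) (hq 5 (by decide)) (hq 6 (by decide))
      (hne (by decide) (by decide)) hout.ne
  · exact QuadraticForm.eq_zero_of_separated (hq 2 (by decide)) (hq 3 (by decide))
      (hq 4 (by decide)) (hq 5 (by decide)) (hq 0 (by decide)) (hq 6 (by decide))
      (hne (by decide) (by decide)) (h0 (by decide) (by decide)) (h0 (by decide) (by decide))
      (h6 (by decide) (by decide)) (h6 (by decide) (by decide)) s1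
  · exact QuadraticForm.eq_zero_of_separated (hq 1 (by decide)) (hq 3 (by decide))
      (hq 4 (by decide)) (hq 5 (by decide)) (hq 0 (by decide)) (hq 6 (by decide))
      (hne (by decide) (by decide)) (h0 (by decide) (by decide)) (h0 (by decide) (by decide))
      (h6 (by decide) (by decide)) (h6 (by decide) (by decide)) s2
  · exact QuadraticForm.eq_zero_of_separated (hq 1 (by decide)) (hq 2 (by decide))
      (hq 4 (by decide)) (hq 5 (by decide)) (hq 0 (by decide)) (hq 6 (by decide))
      (hne (by decide) (by decide)) (h0 (by decide) (by decide)) (h0 (by decide) (by decide))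
      (h6 (by decide) (by decide)) (h6 (by decide) (by decide)) s3
  · exact QuadraticForm.eq_zero_of_separated (hq 1 (by decide)) (hq 2 (by decide))
      (hq 3 (by decide)) (hq 5 (by decide)) (hq 0 (by decide)) (hq 6 (by decide))
      (hne (by decide) (by decide)) (h0 (by decide) (by decide)) (h0 (by decide) (by decide))
      (h6 (by decide) (by decide)) (h6 (by decide) (by decide)) s4
  · exact QuadraticForm.eq_zero_of_separated (hq 1 (by decide)) (hq 2 (by decide))
      (hq 3 (by decide)) (hq 4 (by decide)) (hq 0 (by decide)) (hq 6 (by decide))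
      (hne (by decide) (by decide)) (h0 (by decide) (by decide)) (h0 (by decide) (by decide))
      (h6 (by decide) (by decide)) (h6 (by decide) (by decide)) s5
  · exact QuadraticForm.eq_zero_of_conic_ne_zero (hq 1 (by decide)) (hq 2 (by decide))
      (hq 3 (by decide)) (hq 4 (by decide)) (hq 5 (by decide)) (hq 0 (by decide))
      (hne (by decide) (by decide)) hin.ne'

theorem linearIndependent_iff_br_ne_zero {a b c : Fin 3 → ℝ} :
    LinearIndependent ℝ ![a, b, c] ↔ br a b c ≠ 0 := by
  have h := Matrix.linearIndependent_rows_iff_isUnit (A := Matrix.of ![a, b, c])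
  rw [Matrix.isUnit_iff_isUnit_det, isUnit_iff_ne_zero] at h
  have h2 : (Matrix.of ![a, b, c]).det = br a b c := by
    rw [Matrix.det_fin_three]; simp [br]; ring
  rw [h2] at h
  exact h

theorem br_smul_smul_smul (a b c : Fin 3 → ℝ) (r s t : ℝ) :
    br (r • a) (s • b) (t • c) = r * s * t * br a b c := by
  simp only [br, Pi.smul_apply, smul_eq_mul]; ring

/-- A choice of nonzero vectors representing the points of a configuration. -/
def IsLift {n : ℕ} (f : Fin n → RP2) (p : Fin n → Fin 3 → ℝ) : Prop :=
  ∀ i, ∃ s : ℝ, s ≠ 0 ∧ p i = s • (f i).rep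

section Lift

variable {n : ℕ} {f : Fin n → RP2} {p : Fin n → Fin 3 → ℝ}

theorem IsLift.ne_zero (h : IsLift f p) (i : Fin n) : p i ≠ 0 := by
  obtain ⟨s, hs, hp⟩ := h i
  rw [hp]
  exact smul_ne_zero hs (f i).rep_nonzero

theorem IsLift.mk_eq (h : IsLift f p) (i : Fin n) (hi : p i ≠ 0) : mk ℝ (p i) hi = f i := by
  obtain ⟨s, hs, hp⟩ := h i
  conv_rhs => rw [← (f i).mk_rep]
  rw [mk_eq_mk_iff']
  exact ⟨s, hp.symm⟩

theorem isLift_mk (hp : ∀ i, p i ≠ 0) : IsLift (fun i => mk ℝ (p i) (hp i)) p := by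
  intro i
  obtain ⟨s, hs⟩ := exists_smul_eq_mk_rep ℝ (p i) (hp i)
  refine ⟨((s⁻¹ : ℝˣ) : ℝ), s⁻¹.ne_zero, ?_⟩
  rw [← hs]
  exact (inv_smul_smul s (p i)).symm

theorem IsLift.collin_iff (h : IsLift f p) (i j k : Fin n) :
    Collin (f i) (f j) (f k) ↔ br (p i) (p j) (p k) = 0 := by
  obtain ⟨r, hr, hi⟩ := h i
  obtain ⟨s, hs, hj⟩ := h j
  obtain ⟨t, ht, hk⟩ := h k
  rw [Collin, linearIndependent_iff_br_ne_zero, not_not, hi, hj, hk, br_smul_smul_smul]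
  simp [hr, hs, ht]

theorem IsLift.quadraticForm_eq_zero_iff (h : IsLift f p) (q : QuadraticForm ℝ (Fin 3 → ℝ))
    (i : Fin n) : q (f i).rep = 0 ↔ q (p i) = 0 := by
  obtain ⟨s, hs, hi⟩ := h i
  rw [hi, QuadraticMap.map_smul]
  simp [hs]

end Lift

theorem Heptagon.br_ne_zero {p : Fin 7 → Fin 3 → ℝ} (h : Heptagon p) {i j k : Fin 7}
    (hij : i ≠ j) (hik : i ≠ k) (hjk : j ≠ k) : br (p i) (p j) (p k) ≠ 0 := by
  have hp := fun i j k hij hjk => (h.br_pos i j k hij hjk).ne'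
  rcases lt_or_gt_of_ne hij with h1 | h1 <;> rcases lt_or_gt_of_ne hik with h2 | h2 <;>
    rcases lt_or_gt_of_ne hjk with h3 | h3
  · exact hp _ _ _ h1 h3
  · rw [br_swap_right]; exact neg_ne_zero.mpr (hp _ _ _ h2 h3)
  · exact absurd (h1.trans h3) h2.not_gt
  · rw [br_rotate (p k)]; exact hp _ _ _ h2 h1
  · rw [br_swap]; exact neg_ne_zero.mpr (hp _ _ _ h1 h2)
  · exact absurd (h1.trans h2) h3.not_gt
  · rw [← br_rotate]; exact hp _ _ _ h3 h2
  · rw [br_swap, br_rotate]; exact neg_ne_zero.mpr (hp _ _ _ h3 h1)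

/-- A configuration represented by a heptagon is typical. -/
theorem Heptagon.typicalCfg {p : Fin 7 → Fin 3 → ℝ} (h : Heptagon p) {f : Fin 7 → RP2}
    (hf : IsLift f p) : TypicalCfg f := by
  refine ⟨⟨?_, ?_⟩, ?_⟩
  · intro i j hij
    by_contra hne
    obtain ⟨k, hki, hkj⟩ : ∃ k, i ≠ k ∧ j ≠ k := by
      clear hne hij
      revert i j
      decide
    refine h.br_ne_zero hne hki hkj ((hf.collin_iff i j k).mp ?_)
    rw [hij, Collin, linearIndependent_iff_br_ne_zero, not_not, br_self_left]
  · intro i j k hij hik hjk hc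
    exact h.br_ne_zero hij hik hjk ((hf.collin_iff i j k).mp hc)
  · rintro g hg ⟨q, hq0, hq⟩
    obtain ⟨i, hi⟩ : ∃ i, ∀ j, j ≠ i → j ∈ Set.range g := by
      have hcard : (Finset.univ \ Finset.univ.image g).card = 1 := by
        rw [Finset.card_sdiff_of_subset (Finset.subset_univ _),
          Finset.card_image_of_injective _ hg]
        rfl
      obtain ⟨i, hi⟩ := Finset.card_eq_one.mp hcard
      refine ⟨i, fun j hj => ?_⟩
      by_contra hjg
      refine hj (Finset.mem_singleton.mp (hi ▸ ?_))
      simpa using fun k hk => hjg ⟨k, hk⟩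
    refine hq0 (h.eq_zero_of_six (i := i) fun j hj => ?_)
    obtain ⟨k, rfl⟩ := hi j hj
    exact (hf.quadraticForm_eq_zero_iff q _).mp (hq _ ⟨k, rfl⟩)

theorem exists_equiv_fin_strictMono {α : Type*} [Fintype α] {n : ℕ} (hn : Fintype.card α = n)
    (r : α → α → Prop) [IsStrictTotalOrder α r] :
    ∃ σ : Fin n ≃ α, ∀ i j, i < j → r (σ i) (σ j) := by
  classical
  let _ := linearOrderOfSTO r
  exact ⟨(Fintype.orderIsoFinOfCardEq α hn).toEquiv,
    fun i j hij => (Fintype.orderIsoFinOfCardEq α hn).strictMono hij⟩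

/-- A point of the plane `φ = 1` inside a triangle lies in the convex hull of its vertices. -/
theorem mem_convexHull_of_br_pos {φ : (Fin 3 → ℝ) →ₗ[ℝ] ℝ} {s : Set (Fin 3 → ℝ)}
    (hφ : ∀ x ∈ s, φ x = 1) {a b c x : Fin 3 → ℝ} (ha : a ∈ s) (hb : b ∈ s) (hc : c ∈ s)
    (hx : φ x = 1) (hab : 0 < br a b x) (hbc : 0 < br b c x) (hca : 0 < br c a x) :
    x ∈ convexHull ℝ s := by
  have h := br_cramer a b c x
  rw [← br_rotate x b c, ← br_rotate a x c, ← br_rotate x c a] at h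
  have h1 := congrArg φ h
  simp only [map_add, map_smul, hφ a ha, hφ b hb, hφ c hc, hx, smul_eq_mul, mul_one] at h1
  have hpos : 0 < br a b c := by linarith
  have h2 : x = ((br a b c)⁻¹ * br b c x) • a + ((br a b c)⁻¹ * br c a x) • b +
      ((br a b c)⁻¹ * br a b x) • c := by
    rw [mul_smul, mul_smul, mul_smul, ← smul_add, ← smul_add, ← h, inv_smul_smul₀ hpos.ne']
  have h3 := (convex_convexHull ℝ s).sum_mem (t := Finset.univ)
    (w := ![(br a b c)⁻¹ * br b c x, (br a b c)⁻¹ * br c a x, (br a b c)⁻¹ * br a b x])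
    (z := ![a, b, c])
    (by intro i _; fin_cases i <;> simp <;> positivity)
    (by
      simp only [Fin.sum_univ_three, Matrix.cons_val_zero, Matrix.cons_val_one, Matrix.cons_val]
      rw [← mul_add, ← mul_add, ← h1, inv_mul_cancel₀ hpos.ne'])
    (by
      intro i _
      fin_cases i
      · exact subset_convexHull ℝ s ha
      · exact subset_convexHull ℝ s hb
      · exact subset_convexHull ℝ s hc)
  rw [h2]
  simpa [Fin.sum_univ_three] using h3

/-- A configuration in convex position can be labelled so that all the ordered brackets are
positive. -/
theorem exists_perm_br_pos {n : ℕ} [NeZero n] {φ : (Fin 3 → ℝ) →ₗ[ℝ] ℝ} {v : Fin n → Fin 3 → ℝ}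
    (hφ : ∀ i, φ (v i) = 1) (hv : ∀ i, v i ∉ convexHull ℝ (v '' {j | j ≠ i}))
    (hbr : ∀ i j k, i ≠ j → i ≠ k → j ≠ k → br (v i) (v j) (v k) ≠ 0) :
    ∃ σ : Equiv.Perm (Fin n), ∀ i j k, i < j → j < k →
      0 < br (v (σ i)) (v (σ j)) (v (σ k)) := by
  have inside : ∀ {i j k l}, j ≠ i → k ≠ i → l ≠ i → 0 < br (v j) (v k) (v i) →
      0 < br (v k) (v l) (v i) → 0 < br (v l) (v j) (v i) → False := by
    intro i j k l hj hk hl h1 h2 h3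
    refine hv i (mem_convexHull_of_br_pos ?_ (Set.mem_image_of_mem v hj)
      (Set.mem_image_of_mem v hk) (Set.mem_image_of_mem v hl) (hφ i) h1 h2 h3)
    rintro _ ⟨m, -, rfl⟩
    exact hφ m
  have rot : ∀ i j k, br (v j) (v k) (v i) = br (v i) (v j) (v k) := fun _ _ _ => br_rotate _ _ _
  have swap : ∀ i j k, br (v i) (v k) (v j) = -br (v i) (v j) (v k) :=
    fun _ _ _ => br_swap_right _ _ _
  let r : Fin n → Fin n → Prop := fun i j =>
    (i = 0 ∧ j ≠ 0) ∨ (i ≠ 0 ∧ j ≠ 0 ∧ 0 < br (v 0) (v i) (v j))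
  have irrefl : ∀ i, ¬ r i i := by
    rintro i (⟨h1, h2⟩ | ⟨-, -, h⟩)
    · exact h2 h1
    · rw [br_self_right] at h
      exact h.false
  have trans : ∀ i j k, r i j → r j k → r i k := by
    rintro i j k (⟨hi, hj⟩ | ⟨hi, hj, hij⟩) (⟨hj', hk⟩ | ⟨-, hk, hjk⟩)
    · exact absurd hj' hj
    · exact Or.inl ⟨hi, hk⟩
    · exact absurd hj' hj
    · refine Or.inr ⟨hi, hk, ?_⟩
      have hik : i ≠ k := by
        rintro rfl
        rw [swap] at hjk
        linarith
      by_contra hcon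
      have hlt := lt_of_le_of_ne (not_lt.mp hcon) (hbr 0 i k hi.symm hk.symm hik)
      refine inside hi hj hk (by rwa [rot]) (by rwa [rot]) ?_
      rw [rot, swap]
      linarith
  have trich : ∀ i j, ¬ r i j → ¬ r j i → i = j := by
    intro i j hij hji
    by_contra hne
    by_cases hi : i = 0
    · exact hij (Or.inl ⟨hi, fun hj => hne (hi.trans hj.symm)⟩)
    by_cases hj : j = 0
    · exact hji (Or.inl ⟨hj, hi⟩)
    rcases lt_or_gt_of_ne (hbr 0 i j (Ne.symm hi) (Ne.symm hj) hne) with h | h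
    · refine hji (Or.inr ⟨hj, hi, ?_⟩)
      rw [swap]
      linarith
    · exact hij (Or.inr ⟨hi, hj, h⟩)
  have : IsStrictTotalOrder (Fin n) r := { trichotomous := trich, irrefl := irrefl, trans := trans }
  obtain ⟨σ, hσ⟩ := exists_equiv_fin_strictMono (Fintype.card_fin n) r
  have hσ0 : σ 0 = 0 := by
    by_contra h0
    have h1 : 0 < σ.symm 0 := Fin.pos_iff_ne_zero.mpr fun h =>
      h0 ((Equiv.symm_apply_eq σ).mp h).symm
    have h2 := hσ _ _ h1
    rw [Equiv.apply_symm_apply] at h2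
    rcases h2 with ⟨-, h⟩ | ⟨-, h, -⟩ <;> exact h rfl
  have hne : ∀ {i}, 0 < i → σ i ≠ 0 := fun {i} hi h =>
    hi.ne (σ.injective (hσ0.trans h.symm))
  have h0 : ∀ {j k}, 0 < j → j < k → 0 < br (v 0) (v (σ j)) (v (σ k)) := by
    intro j k hj hjk
    rcases hσ j k hjk with ⟨h, -⟩ | ⟨-, -, h⟩
    · exact absurd h (hne hj)
    · exact h
  refine ⟨σ, fun i j k hij hjk => ?_⟩
  rcases (Fin.zero_le i).eq_or_lt with rfl | hi
  · rw [hσ0]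
    exact h0 hij hjk
  by_contra hcon
  have hij' : σ i ≠ σ j := fun h => hij.ne (σ.injective h)
  have hjk' : σ j ≠ σ k := fun h => hjk.ne (σ.injective h)
  have hik' : σ i ≠ σ k := fun h => (hij.trans hjk).ne (σ.injective h)
  have hlt := lt_of_le_of_ne (not_lt.mp hcon) (hbr _ _ _ hij' hik' hjk')
  refine inside (i := σ j) (j := 0) (k := σ i) (l := σ k) (hne (hi.trans hij)).symm hij'
    hjk'.symm (h0 hi hij) ?_ ?_
  · rw [swap]
    linarith
  · rw [← rot]
    exact h0 (hi.trans hij) hjk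

/-- The quadratic form of the conic through five vectors. -/
def conicQuadraticForm (a b c d e : Fin 3 → ℝ) : QuadraticForm ℝ (Fin 3 → ℝ) :=
  LinearMap.BilinMap.toQuadraticMap <| LinearMap.mk₂ ℝ (conicForm a b c d e)
    (fun x y z => by simp only [conicForm, br_add_right]; ring)
    (fun s x y => by simp only [conicForm, br_smul_right, smul_eq_mul]; ring)
    (fun x y z => by simp only [conicForm, br_add_right]; ring)
    (fun s x y => by simp only [conicForm, br_smul_right, smul_eq_mul]; ring)

theorem conicQuadraticForm_apply (a b c d e x : Fin 3 → ℝ) :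
    conicQuadraticForm a b c d e x = conic a b c d e x := rfl

theorem conicQuadraticForm_ne_zero {a b c d e : Fin 3 → ℝ} (h1 : br a d e ≠ 0)
    (h2 : br b d e ≠ 0) (h3 : br c d e ≠ 0) (h4 : br a b c ≠ 0) :
    conicQuadraticForm a b c d e ≠ 0 := by
  intro h
  have h5 := congrArg (fun q : QuadraticForm ℝ (Fin 3 → ℝ) => q (d + e)) h
  simp only [conicQuadraticForm_apply, conic_add, conic_self₄, conic_self₅, conicPolar_self₄₅,
    zero_apply, zero_add, add_zero] at h5
  exact mul_ne_zero (mul_ne_zero (mul_ne_zero h1 h2) h3) h4 h5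

/-- Seven vectors of `ℝ³` have linearly dependent squares. -/
theorem exists_sum_mul_quadraticForm_eq_zero (p : Fin 7 → Fin 3 → ℝ) :
    ∃ c : Fin 7 → ℝ, (∃ i, c i ≠ 0) ∧
      ∀ q : QuadraticForm ℝ (Fin 3 → ℝ), ∑ i, c i * q (p i) = 0 := by
  let m : Fin 7 → Fin 6 → ℝ := fun i =>
    ![p i 0 ^ 2, p i 1 ^ 2, p i 2 ^ 2, p i 0 * p i 1, p i 0 * p i 2, p i 1 * p i 2]
  have hm : ¬ LinearIndependent ℝ m := by
    intro h
    have := h.fintype_card_le_finrank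
    simp at this
  obtain ⟨c, hc, hne⟩ := Fintype.not_linearIndependent_iff.mp hm
  refine ⟨c, hne, fun q => ?_⟩
  let u : Fin 6 → ℝ := ![q (Pi.single 0 1), q (Pi.single 1 1), q (Pi.single 2 1),
    QuadraticMap.polar q (Pi.single 0 1) (Pi.single 1 1),
    QuadraticMap.polar q (Pi.single 0 1) (Pi.single 2 1),
    QuadraticMap.polar q (Pi.single 1 1) (Pi.single 2 1)]
  have hq : ∀ i, q (p i) = ∑ k, u k * m i k := by
    intro i
    have hp : p i = p i 0 • Pi.single 0 1 + p i 1 • Pi.single 1 1 + p i 2 • Pi.single 2 1 := by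
      funext k
      fin_cases k <;> simp
    conv_lhs => rw [hp]
    rw [QuadraticMap.map_add q, QuadraticMap.map_add q, QuadraticMap.polar_add_left]
    simp only [QuadraticMap.map_smul, QuadraticMap.polar_smul_left,
      QuadraticMap.polar_smul_right, smul_eq_mul]
    simp [Fin.sum_univ_six, u, m]
    ring
  simp only [hq, Finset.mul_sum]
  rw [Finset.sum_comm]
  refine Finset.sum_eq_zero fun k _ => ?_
  have hk := congrFun hc k
  simp only [Finset.sum_apply, Pi.smul_apply, smul_eq_mul, Pi.zero_apply] at hk
  calc ∑ i, c i * (u k * m i k) = u k * ∑ i, c i * m i k := by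
        rw [Finset.mul_sum]; exact Finset.sum_congr rfl fun i _ => by ring
    _ = 0 := by rw [hk, mul_zero]

/-- A cyclic sequence of seven numbers cannot have all its consecutive products negative. -/
theorem exists_mul_nonneg_of_cyclic (c : Fin 7 → ℝ) : ∃ r, 0 ≤ c r * c (r + 6) := by
  by_contra! h
  have h0 : c 0 * c 6 < 0 := h 0
  have h1 : c 1 * c 0 < 0 := h 1
  have h2 : c 2 * c 1 < 0 := h 2
  have h3 : c 3 * c 2 < 0 := h 3
  have h4 : c 4 * c 3 < 0 := h 4
  have h5 : c 5 * c 4 < 0 := h 5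
  have h6 : c 6 * c 5 < 0 := h 6
  have e1 := mul_pos_of_neg_of_neg (mul_neg_of_neg_of_pos h0 (mul_pos_of_neg_of_neg h1 h2))
    (mul_neg_of_neg_of_pos h3 (mul_pos_of_neg_of_neg h4 h5))
  have e2 := mul_neg_of_pos_of_neg e1 h6
  have e3 : 0 ≤ (c 0 * c 1 * c 2 * c 3 * c 4 * c 5 * c 6) ^ 2 := sq_nonneg _
  linarith

theorem br_pos_rotate {p : Fin 7 → Fin 3 → ℝ}
    (hp : ∀ i j k, i < j → j < k → 0 < br (p i) (p j) (p k)) (r : Fin 7) :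
    ∀ i j k, i < j → j < k → 0 < br (p (i + r)) (p (j + r)) (p (k + r)) := by
  intro i j k hij hjk
  have key : ∀ r i j k : Fin 7, i < j → j < k → (i + r < j + r ∧ j + r < k + r) ∨
      (j + r < k + r ∧ k + r < i + r) ∨ (k + r < i + r ∧ i + r < j + r) := by decide
  rcases key r i j k hij hjk with ⟨h1, h2⟩ | ⟨h1, h2⟩ | ⟨h1, h2⟩
  · exact hp _ _ _ h1 h2
  · rw [← br_rotate]
    exact hp _ _ _ h1 h2
  · rw [br_rotate (p (k + r))]
    exact hp _ _ _ h1 h2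

/-- Among seven cyclically ordered vectors, some two consecutive ones are not strictly on the
same side of the conic through the other five. -/
theorem exists_conic_mul_conic_nonpos (p : Fin 7 → Fin 3 → ℝ) :
    ∃ r : Fin 7, conic (p (1 + r)) (p (2 + r)) (p (3 + r)) (p (4 + r)) (p (5 + r)) (p (0 + r)) *
      conic (p (1 + r)) (p (2 + r)) (p (3 + r)) (p (4 + r)) (p (5 + r)) (p (6 + r)) ≤ 0 := by
  obtain ⟨c, ⟨i, hi⟩, hc⟩ := exists_sum_mul_quadraticForm_eq_zero p
  have hrel : ∀ r, c r *
      conic (p (1 + r)) (p (2 + r)) (p (3 + r)) (p (4 + r)) (p (5 + r)) (p (0 + r)) +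
      c (r + 6) *
      conic (p (1 + r)) (p (2 + r)) (p (3 + r)) (p (4 + r)) (p (5 + r)) (p (6 + r)) = 0 := by
    intro r
    have h := hc (conicQuadraticForm (p (1 + r)) (p (2 + r)) (p (3 + r)) (p (4 + r)) (p (5 + r)))
    rw [← Equiv.sum_comp (Equiv.addRight r)] at h
    simp only [Fin.sum_univ_seven, Equiv.coe_addRight, conicQuadraticForm_apply, conic_self₁,
      conic_self₂, conic_self₃, conic_self₄, conic_self₅, mul_zero, add_zero] at h
    rw [add_comm r 6]
    simpa using h
  by_contra! hpos
  have hstep : ∀ r, c r = 0 → c (r + 6) = 0 := by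
    intro r hr
    have h := hrel r
    rw [hr, zero_mul, zero_add] at h
    exact (mul_eq_zero.mp h).resolve_right (right_ne_zero_of_mul (hpos r).ne')
  have hne : ∀ j, c j ≠ 0 := by
    intro j hj
    have h1 := hstep _ hj
    have h2 := hstep _ h1
    have h3 := hstep _ h2
    have h4 := hstep _ h3
    have h5 := hstep _ h4
    have h6 := hstep _ h5
    have key : ∀ i j : Fin 7, i = j ∨ i = j + 6 ∨ i = j + 6 + 6 ∨ i = j + 6 + 6 + 6 ∨
        i = j + 6 + 6 + 6 + 6 ∨ i = j + 6 + 6 + 6 + 6 + 6 ∨ i = j + 6 + 6 + 6 + 6 + 6 + 6 := by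
      decide
    rcases key i j with h | h | h | h | h | h | h <;> rw [h] at hi
    exacts [hi hj, hi h1, hi h2, hi h3, hi h4, hi h5, hi h6]
  obtain ⟨r, hr⟩ := exists_mul_nonneg_of_cyclic c
  have hr' : 0 < c r * c (r + 6) := lt_of_le_of_ne hr (mul_ne_zero (hne _) (hne _)).symm
  have h := hrel r
  have hp := hpos r
  generalize conic (p (1 + r)) (p (2 + r)) (p (3 + r)) (p (4 + r)) (p (5 + r)) (p (0 + r)) = A at *
  generalize conic (p (1 + r)) (p (2 + r)) (p (3 + r)) (p (4 + r)) (p (5 + r)) (p (6 + r)) = B at *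
  have h1 : (c r * c (r + 6)) * (A * B) = -(c r * A) ^ 2 := by
    linear_combination (c r * A) * h
  have h2 := mul_pos hr' hp
  have h3 := sq_nonneg (c r * A)
  linarith

theorem br_neg_neg_neg (a b c : Fin 3 → ℝ) : br (-a) (-b) (-c) = -br a b c := by
  simp only [br, Pi.neg_apply]; ring

theorem conic_neg (a b c d e x : Fin 3 → ℝ) :
    conic (-a) (-b) (-c) (-d) (-e) (-x) = conic a b c d e x := by
  simp only [conic, conicForm, br_neg_neg_neg]; ring

/-- A heptagonal configuration can be labelled so as to be represented by a heptagon. -/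
theorem exists_heptagon {f : Fin 7 → RP2} (hf : TypicalCfg f) (hfc : ConvexPos f) :
    ∃ (σ : Equiv.Perm (Fin 7)) (p : Fin 7 → Fin 3 → ℝ), Heptagon p ∧ IsLift (f ∘ σ) p := by
  obtain ⟨φ, -, hφ, hhull⟩ := hfc
  set v : Fin 7 → Fin 3 → ℝ := fun i => chart φ (f i) with hv
  have hlift : IsLift f v := fun i => ⟨_, inv_ne_zero (hφ i), rfl⟩
  have hφ1 : ∀ i, φ (v i) = 1 := by
    intro i
    simp [hv, chart, hφ i]
  have hbr : ∀ i j k, i ≠ j → i ≠ k → j ≠ k → br (v i) (v j) (v k) ≠ 0 :=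
    fun i j k hij hik hjk h => hf.1.2 i j k hij hik hjk ((hlift.collin_iff i j k).mpr h)
  obtain ⟨σ, hσ⟩ := exists_perm_br_pos hφ1
    (fun i h => hhull i (by rwa [Set.image_image])) hbr
  obtain ⟨r, hr⟩ := exists_conic_mul_conic_nonpos (fun i => v (σ i))
  set p : Fin 7 → Fin 3 → ℝ := fun i => v (σ (i + r)) with hp
  have hpos : ∀ i j k, i < j → j < k → 0 < br (p i) (p j) (p k) := br_pos_rotate hσ r
  have hne : ∀ x, x = 0 ∨ x = 6 → conic (p 1) (p 2) (p 3) (p 4) (p 5) (p x) ≠ 0 := by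
    intro x hx h0
    have hg : Function.Injective ((Equiv.addRight r).trans σ ∘ ![1, 2, 3, 4, 5, x]) := by
      refine (Equiv.injective _).comp ?_
      rcases hx with rfl | rfl <;> decide
    refine hf.2 _ hg ⟨conicQuadraticForm (p 1) (p 2) (p 3) (p 4) (p 5),
      conicQuadraticForm_ne_zero (hpos _ _ _ (by decide) (by decide)).ne'
        (hpos _ _ _ (by decide) (by decide)).ne' (hpos _ _ _ (by decide) (by decide)).ne'
        (hpos _ _ _ (by decide) (by decide)).ne', ?_⟩
    rintro _ ⟨k, rfl⟩
    refine (hlift.quadraticForm_eq_zero_iff _ _).mpr ?_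
    rw [conicQuadraticForm_apply]
    fin_cases k
    · exact conic_self₁ _ _ _ _ _
    · exact conic_self₂ _ _ _ _ _
    · exact conic_self₃ _ _ _ _ _
    · exact conic_self₄ _ _ _ _ _
    · exact conic_self₅ _ _ _ _ _
    · exact h0
  have h0 := hne 0 (Or.inl rfl)
  have h6 := hne 6 (Or.inr rfl)
  have hr' : conic (p 1) (p 2) (p 3) (p 4) (p 5) (p 0) *
    conic (p 1) (p 2) (p 3) (p 4) (p 5) (p 6) < 0 := lt_of_le_of_ne hr (mul_ne_zero h0 h6)
  rcases lt_or_gt_of_ne h0 with hlt | hgt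
  · refine ⟨Fin.revPerm.trans ((Equiv.addRight r).trans σ), fun i => -p (Fin.rev i),
      ⟨?_, ?_, ?_⟩, ?_⟩
    · intro i j k hij hjk
      rw [br_neg_neg_neg, br_swap_right, neg_neg, ← br_rotate]
      exact hpos _ _ _ (Fin.rev_lt_rev.mpr hjk) (Fin.rev_lt_rev.mpr hij)
    · rw [conic_neg]
      refine lt_of_lt_of_eq ?_ (conic_reverse _ _ _ _ _ _).symm
      exact (neg_iff_pos_of_mul_neg hr').mp hlt
    · rw [conic_neg]
      exact lt_of_eq_of_lt (conic_reverse _ _ _ _ _ _) hlt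
    · intro i
      obtain ⟨s, hs, h⟩ := hlift (σ (Fin.rev i + r))
      refine ⟨-s, neg_ne_zero.mpr hs, ?_⟩
      rw [neg_smul]
      exact congrArg Neg.neg h
  · exact ⟨(Equiv.addRight r).trans σ, p, ⟨hpos, hgt, (pos_iff_neg_of_mul_neg hr').mp hgt⟩,
      fun i => hlift (σ (i + r))⟩

theorem continuous_mk {X : Type*} [TopologicalSpace X] {v : X → Fin 3 → ℝ} (hv : Continuous v)
    (hv0 : ∀ x, v x ≠ 0) : Continuous fun x => (mk ℝ (v x) (hv0 x) : RP2) :=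
  (continuous_quotient_mk' (s := projectivizationSetoid ℝ (Fin 3 → ℝ))).comp
    (hv.subtype_mk hv0)

theorem Heptagon.ne_zero {p : Fin 7 → Fin 3 → ℝ} (h : Heptagon p) (i : Fin 7) : p i ≠ 0 := by
  intro hi
  have hb := h.br_ne_zero (i := i) (j := i + 1) (k := i + 2) (by simp) (by simp) (by simp)
  rw [hi] at hb
  exact hb (by simp [br])

theorem IsLift.range_mk_eq {n : ℕ} {f : Fin n → RP2} {σ : Equiv.Perm (Fin n)}
    {p : Fin n → Fin 3 → ℝ} (h : IsLift (f ∘ σ) p) (hp : ∀ i, p i ≠ 0) :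
    (Set.range fun i => (mk ℝ (p i) (hp i) : RP2)) = Set.range f := by
  rw [← σ.surjective.range_comp f]
  exact congrArg Set.range (funext fun i => h.mk_eq i (hp i))

end

noncomputable section

/-- Any two heptagonal typical 7-configurations can be joined by a Q-deformation: the
heptagonal typical 7-configurations form a single Q-deformation class. -/
theorem heptagonal_single_qdeformation_class
    (f g : Fin 7 → RP2) (hf : TypicalCfg f) (hg : TypicalCfg g)
    (hfc : ConvexPos f) (hgc : ConvexPos g) :
    ∃ γ : Fin 7 → unitInterval → RP2, QDeformFam 7 γ ∧
      (Set.range fun i => γ i 0) = Set.range f ∧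
      (Set.range fun i => γ i 1) = Set.range g := by
  obtain ⟨σ, p, hp, hfp⟩ := exists_heptagon hf hfc
  obtain ⟨τ, q, hq, hgq⟩ := exists_heptagon hg hgc
  obtain ⟨δ, hδ⟩ := isPathConnected_heptagon.joinedIn p hp q hq
  have hδ0 : ∀ t i, δ t i ≠ 0 := fun t => (hδ t).ne_zero
  refine ⟨fun i t => Projectivization.mk ℝ (δ t i) (hδ0 t i), ⟨fun i => ?_, fun t => ?_⟩, ?_, ?_⟩
  · exact continuous_mk ((continuous_apply i).comp δ.continuous) fun t => hδ0 t i
  · exact (hδ t).typicalCfg (isLift_mk (hδ0 t))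
  · exact IsLift.range_mk_eq (by rwa [δ.source]) (hδ0 0)
  · exact IsLift.range_mk_eq (by rwa [δ.target]) (hδ0 1)

end
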